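/- Fix a natural number q ≥ 2 and t ∈ [0,1]. Then the intersection 𝓑(t,q) ∩ (0,∞) of the accumulation set of Lee–Yang zeros of the rooted binary Cayley tree with the positive real axis equals: {1} if 0 ≤ t ≤ t₁(q); {𝒵_q(t)} if t₁(q) < t ≤ t₂(q); and ∅ if t₂(q) < t ≤ 1. Here 𝒵_q(t) = [(−27(q−1)²t⁴ + 18(q²−3q+2)t³ + (q²+14q−14)t² + 2(q−2)t + 1) − √((t−1)((q−1)t+1)(9(q−1)t²−(q−2)t−1)³)] / (8t((q−2)t+1)³). -/

import Mathlib

noncomputable section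

/-- The pair `(Z_n^0(z), Z_n^1(z))` of conditional partition functions of the
`q`-state Potts model on the depth-`n` rooted binary Cayley tree, in the
field-like variable `z` and temperature-like variable `t`. -/
def ZZpair (q : ℕ) (t : ℝ) : ℕ → ℂ → ℂ × ℂ
  | 0, z => (z⁻¹, 1)
  | n + 1, z =>
      (z⁻¹ * ((ZZpair q t n z).1 + ((q : ℂ) - 1) * (t : ℂ) * (ZZpair q t n z).2) ^ 2,
       ((t : ℂ) * (ZZpair q t n z).1 + (1 + ((q : ℂ) - 2) * (t : ℂ)) * (ZZpair q t n z).2) ^ 2)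

/-- The full partition function `Z_n(z) = Z_n^0(z) + (q-1)·Z_n^1(z)` of the
rooted binary Cayley tree of depth `n`. -/
def Zrooted (q : ℕ) (t : ℝ) (n : ℕ) (z : ℂ) : ℂ :=
  (ZZpair q t n z).1 + ((q : ℂ) - 1) * (ZZpair q t n z).2

/-- The accumulation set `𝓑(t,q)` of the Lee–Yang zeros of the rooted binary
Cayley tree: the closure of the set of zeros of some `Z_n` in `ℂ ∖ {0}`. -/
def BLY (t : ℝ) (q : ℕ) : Set ℂ :=
  closure {z : ℂ | z ≠ 0 ∧ ∃ n : ℕ, Zrooted q t n z = 0}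

/-- The positive real axis `(0,∞)` viewed as a subset of `ℂ`. -/
def posAxis : Set ℂ := {z : ℂ | ∃ x : ℝ, 0 < x ∧ z = (x : ℂ)}

/-- `t₁(q) = 1/(1+q)`. -/
def tOne (q : ℝ) : ℝ := 1 / (1 + q)

/-- `t₂(q) = (q − 2 + √(q² + 32q − 32))/(18(q − 1))`. -/
def tTwo (q : ℝ) : ℝ := (q - 2 + Real.sqrt (q ^ 2 + 32 * q - 32)) / (18 * (q - 1))

/-- `𝒵_q(t)`, the point at which the Lee–Yang zeros accumulate
when `t₁(q) < t ≤ t₂(q)`. -/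
def calZ (q t : ℝ) : ℝ :=
  ((-27 * (q - 1) ^ 2 * t ^ 4 + 18 * (q ^ 2 - 3 * q + 2) * t ^ 3
      + (q ^ 2 + 14 * q - 14) * t ^ 2 + 2 * (q - 2) * t + 1)
    - Real.sqrt ((t - 1) * ((q - 1) * t + 1) * (9 * (q - 1) * t ^ 2 - (q - 2) * t - 1) ^ 3))
    / (8 * t * ((q - 2) * t + 1) ^ 3)

open Metric Set Filter Topology

section Landau

open Complex

/-- A nonvanishing holomorphic function on a disc has a holomorphic logarithm. -/
theorem exists_log_on_ball {f : ℂ → ℂ} {c : ℂ} {R : ℝ} (hR : 0 < R)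
    (hf : DifferentiableOn ℂ f (ball c R)) (h0 : ∀ z ∈ ball c R, f z ≠ 0) :
    ∃ L : ℂ → ℂ, DifferentiableOn ℂ L (ball c R) ∧ ∀ z ∈ ball c R, exp (L z) = f z := by
  have hc : c ∈ ball c R := mem_ball_self hR
  have hd : DifferentiableOn ℂ (fun z => deriv f z / f z) (ball c R) :=
    (hf.deriv isOpen_ball).div hf h0
  obtain ⟨L, hLc, hL⟩ := hd.isExactOn_ball.with_val_at c (log (f c))
  refine ⟨L, fun z hz => (hL z hz).differentiableAt.differentiableWithinAt, ?_⟩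
  have hconst : ∀ z ∈ ball c R, f z * exp (-L z) = f c * exp (-L c) := by
    intro z hz
    refine (convex_ball c R).is_const_of_fderivWithin_eq_zero (𝕜 := ℂ)
      (f := fun z => f z * exp (-L z)) ?_ ?_ hz hc
    · exact hf.mul (DifferentiableOn.cexp
        (fun z hz => (hL z hz).differentiableAt.differentiableWithinAt.neg))
    · intro w hw
      have h1 : HasDerivAt f (deriv f w) w :=
        (hf.differentiableAt (isOpen_ball.mem_nhds hw)).hasDerivAt
      have h2 : HasDerivAt (fun z => f z * exp (-L z)) 0 w := by
        refine (h1.mul (hL w hw).neg.cexp).congr_deriv ?_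
        field_simp [h0 w hw]
        ring
      rw [fderivWithin_of_isOpen isOpen_ball hw, h2.hasFDerivAt.fderiv]
      ext
      simp
  intro z hz
  have h := hconst z hz
  rw [hLc, exp_neg (log (f c)), exp_log (h0 c hc), mul_inv_cancel₀ (h0 c hc), exp_neg] at h
  field_simp at h
  exact h.symm

/-- A holomorphic function whose derivative at most doubles on a disc covers a disc of radius
proportional to the derivative at the centre. -/
theorem ball_subset_image_of_norm_deriv_le {f : ℂ → ℂ} {a : ℂ} {r : ℝ} (hr : 0 < r)
    (hf : DifferentiableOn ℂ f (ball a r)) (h0 : deriv f a ≠ 0)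
    (h2 : ∀ z ∈ ball a r, ‖deriv f z‖ ≤ 2 * ‖deriv f a‖) :
    ball (f a) (r * ‖deriv f a‖ / 24) ⊆ f '' ball a r := by
  set M := ‖deriv f a‖ with hM
  have hM0 : 0 < M := norm_pos_iff.mpr h0
  have ha : a ∈ ball a r := mem_ball_self hr
  have hsch : ∀ z ∈ ball a r, ‖deriv f z - deriv f a‖ ≤ 3 * M / r * ‖z - a‖ := by
    intro z hz
    have := dist_le_div_mul_dist_of_mapsTo_ball (R₂ := 3 * M) (hf.deriv isOpen_ball)
      (fun w hw => by
        rw [mem_closedBall, dist_eq_norm]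
        calc ‖deriv f w - deriv f a‖ ≤ ‖deriv f w‖ + ‖deriv f a‖ := norm_sub_le _ _
          _ ≤ 3 * M := by linarith [h2 w hw]) hz
    rwa [dist_eq_norm, dist_eq_norm] at this
  have hsub : closedBall a (r / 6) ⊆ ball a r := closedBall_subset_ball (by linarith)
  have hlin : ∀ z ∈ closedBall a (r / 6),
      ‖(f z - f a) - (z - a) * deriv f a‖ ≤ M / 2 * ‖z - a‖ := by
    intro z hz
    have := (convex_closedBall a (r / 6)).norm_image_sub_le_of_norm_hasDerivWithin_le
      (f := fun z => f z - z * deriv f a) (f' := fun z => deriv f z - deriv f a) (C := M / 2)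
      (fun w hw => (((hf.differentiableAt (isOpen_ball.mem_nhds (hsub hw))).hasDerivAt.sub
        (hasDerivAt_mul_const _)).hasDerivWithinAt))
      (fun w hw => ?_) (mem_closedBall_self (by linarith)) hz
    · rw [show f z - f a - (z - a) * deriv f a =
        (f z - z * deriv f a) - (f a - a * deriv f a) by ring]
      exact this
    · refine (hsch w (hsub hw)).trans ?_
      rw [mem_closedBall, dist_eq_norm] at hw
      calc 3 * M / r * ‖w - a‖ ≤ 3 * M / r * (r / 6) := by gcongr
        _ = M / 2 := by field_simp; norm_num
  have hsph : ∀ z ∈ sphere a (r / 6), r * M / 12 ≤ ‖f z - f a‖ := by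
    intro z hz
    have h := hlin z (sphere_subset_closedBall hz)
    rw [mem_sphere, dist_eq_norm] at hz
    have h' : ‖(z - a) * deriv f a‖ ≤ ‖f z - f a‖ + ‖(f z - f a) - (z - a) * deriv f a‖ := by
      have := norm_sub_le (f z - f a) ((f z - f a) - (z - a) * deriv f a)
      rwa [sub_sub_cancel] at this
    rw [norm_mul, hz, ← hM] at h'
    rw [hz] at h
    linarith
  have hdc : DiffContOnCl ℂ f (ball a (r / 6)) :=
    (hf.mono hsub).diffContOnCl_ball subset_rfl
  have hfreq : ∃ᶠ z in 𝓝 a, f z ≠ f a := by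
    have hda : HasDerivAt f (deriv f a) a :=
      (hf.differentiableAt (isOpen_ball.mem_nhds ha)).hasDerivAt
    exact (hda.eventually_ne h0).frequently.filter_mono nhdsWithin_le_nhds
  have := hdc.ball_subset_image_closedBall (by linarith) hsph hfreq
  refine Subset.trans ?_ (this.trans (image_mono hsub))
  apply ball_subset_ball
  linarith

/-- **Bloch's theorem**, with a non-optimal constant. -/
theorem bloch {f : ℂ → ℂ} {c : ℂ} {R : ℝ} (hR : 0 < R)
    (hf : DifferentiableOn ℂ f (ball c R)) (h0 : deriv f c ≠ 0) :
    ∃ w, ball w (R * ‖deriv f c‖ / 96) ⊆ f '' ball c R := by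
  have hsub : closedBall c (R / 2) ⊆ ball c R := closedBall_subset_ball (by linarith)
  have hcont : ContinuousOn (fun z => ‖deriv f z‖ * (R / 2 - dist z c)) (closedBall c (R / 2)) :=
    (((hf.deriv isOpen_ball).continuousOn.mono hsub).norm).mul (by fun_prop)
  obtain ⟨a, ha, hmax⟩ := (isCompact_closedBall c (R / 2)).exists_isMaxOn
    ⟨c, mem_closedBall_self (by linarith)⟩ hcont
  have hmax' : ∀ z ∈ closedBall c (R / 2),
      ‖deriv f z‖ * (R / 2 - dist z c) ≤ ‖deriv f a‖ * (R / 2 - dist a c) := fun z hz => hmax hz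
  have hpos : 0 < ‖deriv f c‖ := norm_pos_iff.mpr h0
  have hc := hmax' c (mem_closedBall_self (by linarith))
  rw [dist_self, sub_zero] at hc
  rw [mem_closedBall] at ha
  have hprod : 0 < ‖deriv f a‖ * (R / 2 - dist a c) := lt_of_lt_of_le (by positivity) hc
  have ha0 : 0 < ‖deriv f a‖ := by
    rcases (norm_nonneg (deriv f a)).eq_or_lt with h | h
    · rw [← h, zero_mul] at hprod
      exact absurd hprod (lt_irrefl _)
    · exact h
  have hd0 : 0 < R / 2 - dist a c := pos_of_mul_pos_right hprod ha0.le
  set r := (R / 2 - dist a c) / 2 with hr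
  have hr0 : 0 < r := by positivity
  have hball : ∀ z ∈ ball a r, dist z c < R / 2 - r := by
    intro z hz
    rw [mem_ball] at hz
    linarith [dist_triangle z a c]
  have hball' : ball a r ⊆ ball c R := fun z hz => by
    have := hball z hz
    rw [mem_ball]
    linarith
  refine ⟨f a, Subset.trans ?_ ((ball_subset_image_of_norm_deriv_le hr0 (hf.mono hball')
    (norm_pos_iff.mp ha0) ?_).trans (image_mono hball'))⟩
  · apply ball_subset_ball
    have : r * ‖deriv f a‖ = ‖deriv f a‖ * (R / 2 - dist a c) / 2 := by rw [hr]; ring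
    rw [this]
    linarith
  · intro z hz
    have h1 := hball z hz
    have h2 := hmax' z (mem_closedBall.mpr (by linarith))
    have h3 : ‖deriv f z‖ * r ≤ ‖deriv f z‖ * (R / 2 - dist z c) := by
      gcongr
      linarith
    have h4 : ‖deriv f a‖ * (R / 2 - dist a c) = 2 * ‖deriv f a‖ * r := by rw [hr]; ring
    exact le_of_mul_le_mul_right (by linarith) hr0

/-- The points at which `cosh²` takes an integer value meet every disc of radius `5`. -/
theorem exists_cosh_sq_eq_int (w : ℂ) : ∃ v ∈ ball w 5, ∃ n : ℤ, cosh v ^ 2 = n := by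
  have key : ∀ y : ℝ, 0 ≤ y → ∃ x, y ≤ x ∧ x ≤ y + 1 ∧ ∃ n : ℤ, Real.cosh x ^ 2 = n := by
    intro y hy
    have hgrow : Real.cosh y ^ 2 + 1 ≤ Real.cosh (y + 1) ^ 2 := by
      have h1 : 1 ≤ Real.cosh y := Real.one_le_cosh y
      have h2 : (3 : ℝ) / 2 ≤ Real.cosh 1 := by
        rw [Real.cosh_eq]
        linarith [Real.exp_one_gt_d9, Real.exp_neg_one_gt_d9]
      have h3 : Real.cosh y * (3 / 2) ≤ Real.cosh (y + 1) := by
        rw [Real.cosh_add]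
        have : 0 ≤ Real.sinh y * Real.sinh 1 :=
          mul_nonneg (Real.sinh_nonneg_iff.mpr hy) (Real.sinh_nonneg_iff.mpr zero_le_one)
        nlinarith
      nlinarith
    have hmem : ((⌈Real.cosh y ^ 2⌉ : ℤ) : ℝ) ∈ Icc (Real.cosh y ^ 2) (Real.cosh (y + 1) ^ 2) :=
      ⟨Int.le_ceil _, by linarith [Int.ceil_lt_add_one (Real.cosh y ^ 2)]⟩
    obtain ⟨x, hx, hxe⟩ := intermediate_value_Icc (f := fun x => Real.cosh x ^ 2)
      (by linarith : y ≤ y + 1) (by fun_prop) hmem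
    exact ⟨x, hx.1, hx.2, _, hxe⟩
  have key' : ∃ x : ℝ, |x - w.re| ≤ 1 ∧ ∃ n : ℤ, Real.cosh x ^ 2 = n := by
    rcases le_total 0 w.re with h | h
    · obtain ⟨x, h1, h2, hn⟩ := key _ h
      exact ⟨x, abs_le.mpr ⟨by linarith, by linarith⟩, hn⟩
    · obtain ⟨x, h1, h2, n, hn⟩ := key (-w.re) (by linarith)
      exact ⟨-x, abs_le.mpr ⟨by linarith, by linarith⟩, n, by rwa [Real.cosh_neg]⟩
  obtain ⟨x, hx, n, hn⟩ := key'
  set k : ℤ := round (w.im / Real.pi)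
  have hk : |k * Real.pi - w.im| ≤ 2 := by
    have h := abs_sub_round (w.im / Real.pi)
    have hpi := Real.pi_pos
    have : k * Real.pi - w.im = -(w.im / Real.pi - k) * Real.pi := by field_simp; ring
    rw [this, abs_mul, abs_neg, abs_of_pos hpi]
    have := Real.pi_le_four
    calc _ ≤ (1 / 2 : ℝ) * 4 := by gcongr
      _ = 2 := by norm_num
  refine ⟨x + (k * Real.pi : ℝ) * I, ?_, n, ?_⟩
  · rw [mem_ball, dist_eq_norm]
    refine (norm_le_abs_re_add_abs_im _).trans_lt ?_
    simp only [sub_re, add_re, ofReal_re, mul_re, I_re, mul_zero, ofReal_im, I_im, mul_one,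
      sub_self, add_zero, sub_im, add_im, mul_im, zero_add]
    linarith
  · rw [cosh_add, cosh_mul_I, sinh_mul_I, ← ofReal_cos, ← ofReal_sin, Real.sin_int_mul_pi]
    have hc : Real.cos (k * Real.pi) ^ 2 = 1 := by
      have := Real.sin_sq_add_cos_sq (k * Real.pi)
      rw [Real.sin_int_mul_pi] at this
      linarith
    rw [ofReal_zero, zero_mul, mul_zero, add_zero, mul_pow, ← ofReal_pow, hc, ← ofReal_cosh,
      ← ofReal_pow, hn]
    simp

/-- **Landau's theorem** for functions omitting `0` and `1`, normalised to have modulus one at the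
centre of the disc. -/
theorem landau {f : ℂ → ℂ} {c : ℂ} {R : ℝ} (hR : 0 < R)
    (hf : DifferentiableOn ℂ f (ball c R)) (h0 : ∀ z ∈ ball c R, f z ≠ 0)
    (h1 : ∀ z ∈ ball c R, f z ≠ 1) (hc1 : ‖f c‖ = 1) :
    ‖deriv f c‖ ≤ 2 * Real.pi * (960 / R) := by
  have hc : c ∈ ball c R := mem_ball_self hR
  have hnhds : ball c R ∈ 𝓝 c := isOpen_ball.mem_nhds hc
  obtain ⟨L, hLd, hL⟩ := exists_log_on_ball hR hf h0
  have hLre : (L c).re = 0 := by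
    have := hL c hc
    rw [← this, norm_exp, Real.exp_eq_one_iff] at hc1
    exact hc1
  have hpi : (Real.pi : ℂ) ≠ 0 := ofReal_ne_zero.mpr Real.pi_ne_zero
  set m : ℤ := ⌊(L c).im / (2 * Real.pi)⌋
  set F : ℂ → ℂ := fun z => L z / (2 * Real.pi * I) - m with hF
  have hFd : DifferentiableOn ℂ F (ball c R) := (hLd.div_const _).sub_const _
  have hFexp : ∀ z ∈ ball c R, exp (2 * Real.pi * I * F z) = f z := by
    intro z hz
    rw [← hL z hz, exp_eq_exp_iff_exists_int]
    refine ⟨-m, ?_⟩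
    simp only [hF]
    push_cast
    field_simp
    ring
  have hFint : ∀ z ∈ ball c R, ∀ n : ℤ, F z ≠ n := by
    intro z hz n hn
    apply h1 z hz
    rw [← hFexp z hz, hn, exp_eq_one_iff]
    exact ⟨n, by ring⟩
  have hFc : F c = (Int.fract ((L c).im / (2 * Real.pi)) : ℝ) := by
    have : L c = (L c).im * I := by
      apply Complex.ext <;> simp [hLre]
    simp only [hF]
    rw [this, Int.fract]
    push_cast
    simp only [mul_im, ofReal_re, I_im, mul_one, ofReal_im, I_re, mul_zero, add_zero]
    field_simp
    simp [m]
  have hx0 := Int.fract_nonneg ((L c).im / (2 * Real.pi))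
  have hx1 := (Int.fract_lt_one ((L c).im / (2 * Real.pi))).le
  set x := Int.fract ((L c).im / (2 * Real.pi))
  obtain ⟨P, hPd, hP⟩ := exists_log_on_ball hR hFd (fun z hz => by simpa using hFint z hz 0)
  obtain ⟨Q, hQd, hQ⟩ := exists_log_on_ball hR (hFd.sub_const 1)
    (fun z hz => by simpa [sub_eq_zero] using hFint z hz 1)
  set A : ℂ → ℂ := fun z => exp (P z / 2)
  set B : ℂ → ℂ := fun z => exp (Q z / 2)
  have hA : ∀ z ∈ ball c R, A z ^ 2 = F z := fun z hz => by
    rw [← hP z hz, ← exp_nat_mul]; congr 1; push_cast; ring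
  have hB : ∀ z ∈ ball c R, B z ^ 2 = F z - 1 := fun z hz => by
    rw [← hQ z hz, ← exp_nat_mul]; congr 1; push_cast; ring
  have hAd : DifferentiableOn ℂ A (ball c R) := (hPd.div_const _).cexp
  have hBd : DifferentiableOn ℂ B (ball c R) := (hQd.div_const _).cexp
  have hAB : ∀ z ∈ ball c R, (A z + B z) * (A z - B z) = 1 := fun z hz => by
    linear_combination hA z hz - hB z hz
  obtain ⟨G, hGd, hG⟩ := exists_log_on_ball hR (hAd.add hBd)
    (fun z hz => left_ne_zero_of_mul_eq_one (hAB z hz))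
  have hGneg : ∀ z ∈ ball c R, exp (-G z) = A z - B z := fun z hz => by
    rw [exp_neg, hG z hz]
    exact inv_eq_of_mul_eq_one_right (hAB z hz)
  have hcosh : ∀ z ∈ ball c R, cosh (G z) = A z := fun z hz => by
    rw [cosh, hG z hz, hGneg z hz, Pi.add_apply]; ring
  have hsinh : ∀ z ∈ ball c R, sinh (G z) = B z := fun z hz => by
    rw [sinh, hG z hz, hGneg z hz, Pi.add_apply]; ring
  have hG' : ‖deriv G c‖ ≤ 480 / R := by
    by_contra! hlt
    have hne : deriv G c ≠ 0 := norm_pos_iff.mp (lt_trans (by positivity) hlt)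
    obtain ⟨w, hw⟩ := bloch hR hGd hne
    obtain ⟨v, hv, n, hn⟩ := exists_cosh_sq_eq_int w
    have h5 : (5 : ℝ) ≤ R * ‖deriv G c‖ / 96 := by
      rw [div_lt_iff₀ hR] at hlt
      linarith
    obtain ⟨z, hz, rfl⟩ := hw (ball_subset_ball h5 hv)
    exact hFint z hz n (by rw [← hA z hz, ← hcosh z hz, hn])
  have hGda : HasDerivAt G (deriv G c) c := (hGd.differentiableAt hnhds).hasDerivAt
  have hfd : HasDerivAt f (exp (2 * Real.pi * I * (cosh (G c)) ^ 2) *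
      (2 * Real.pi * I * (2 * cosh (G c) * (sinh (G c) * deriv G c)))) c := by
    have h := (((hGda.ccosh).pow 2).const_mul (2 * Real.pi * I)).cexp
    refine (h.congr_of_eventuallyEq ?_).congr_deriv (by simp)
    filter_upwards [hnhds] with z hz
    simp only [Pi.pow_apply]
    rw [hcosh z hz, hA z hz, hFexp z hz]
  have hAc : ‖A c‖ ≤ 1 := by
    have : ‖A c‖ ^ 2 = x := by
      rw [← norm_pow, hA c hc, hFc, norm_real, Real.norm_of_nonneg hx0]
    nlinarith [norm_nonneg (A c)]
  have hBc : ‖B c‖ ≤ 1 := by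
    have : ‖B c‖ ^ 2 = 1 - x := by
      rw [← norm_pow, hB c hc, hFc, ← ofReal_one, ← ofReal_sub, norm_real, Real.norm_eq_abs,
        abs_of_nonpos (by linarith)]
      ring
    nlinarith [norm_nonneg (B c)]
  rw [hfd.deriv, hcosh c hc, hA c hc, hFexp c hc, hsinh c hc]
  simp only [norm_mul, hc1, norm_I, norm_real, Real.norm_of_nonneg Real.pi_pos.le, norm_ofNat]
  calc 1 * (2 * Real.pi * 1 * (2 * ‖A c‖ * (‖B c‖ * ‖deriv G c‖)))
      ≤ 1 * (2 * Real.pi * 1 * (2 * 1 * (1 * (480 / R)))) := by gcongr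
    _ = 2 * Real.pi * (960 / R) := by ring

end Landau

/-- The numerator coefficient `(q-1)t` of the spin recursion. -/
def coeffA (q : ℕ) (t : ℝ) : ℝ := ((q : ℝ) - 1) * t

/-- The denominator coefficient `1+(q-2)t` of the spin recursion. -/
def coeffB (q : ℕ) (t : ℝ) : ℝ := 1 + ((q : ℝ) - 2) * t

/-- The Möbius map underlying the recursion of the ratios `Z_n^0 / Z_n^1`. -/
def mobius (q : ℕ) (t x : ℝ) : ℝ := (x + coeffA q t) / (t * x + coeffB q t)

/-- The derivative of `mobius`. -/
def mobiusDeriv (q : ℕ) (t x : ℝ) : ℝ :=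
  (coeffB q t - coeffA q t * t) / (t * x + coeffB q t) ^ 2

/-- The ratios `Z_n^0 / Z_n^1` at the real field `z = l⁻¹`. -/
def ratio (q : ℕ) (t l : ℝ) : ℕ → ℝ
  | 0 => l
  | n + 1 => l * mobius q t (ratio q t l n) ^ 2

/-- The derivatives of the ratios `Z_n^0 / Z_n^1` with respect to `l = z⁻¹`. -/
def ratioDeriv (q : ℕ) (t l : ℝ) : ℕ → ℝ
  | 0 => 1
  | n + 1 => mobius q t (ratio q t l n) * (mobius q t (ratio q t l n) +
      2 * l * mobiusDeriv q t (ratio q t l n) * ratioDeriv q t l n)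

section Basic

variable {q : ℕ} {t : ℝ}

theorem one_le_cast_sub_one (hq : 2 ≤ q) : (1 : ℝ) ≤ (q : ℝ) - 1 := by
  have : (2 : ℝ) ≤ q := by exact_mod_cast hq
  linarith

theorem coeffA_nonneg (hq : 2 ≤ q) (ht0 : 0 ≤ t) : 0 ≤ coeffA q t :=
  mul_nonneg (by linarith [one_le_cast_sub_one hq]) ht0

theorem one_le_coeffB (hq : 2 ≤ q) (ht0 : 0 ≤ t) : 1 ≤ coeffB q t := by
  have : 0 ≤ ((q : ℝ) - 2) * t := mul_nonneg (by linarith [one_le_cast_sub_one hq]) ht0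
  rw [coeffB]
  linarith

theorem coeff_det (q : ℕ) (t : ℝ) :
    coeffB q t - coeffA q t * t = (1 - t) * (1 + coeffA q t) := by
  rw [coeffA, coeffB]
  ring

theorem coeff_det_nonneg (hq : 2 ≤ q) (ht0 : 0 ≤ t) (ht1 : t ≤ 1) :
    0 ≤ coeffB q t - coeffA q t * t := by
  rw [coeff_det]
  exact mul_nonneg (by linarith) (by linarith [coeffA_nonneg hq ht0])

theorem mobius_denom_pos (hq : 2 ≤ q) (ht0 : 0 ≤ t) {x : ℝ} (hx : 0 ≤ x) :
    0 < t * x + coeffB q t := by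
  have := one_le_coeffB hq ht0
  positivity

theorem mobius_pos (hq : 2 ≤ q) (ht0 : 0 ≤ t) {x : ℝ} (hx : 0 < x) : 0 < mobius q t x :=
  div_pos (by linarith [coeffA_nonneg hq ht0]) (mobius_denom_pos hq ht0 hx.le)

theorem mobiusDeriv_nonneg (hq : 2 ≤ q) (ht0 : 0 ≤ t) (ht1 : t ≤ 1) (x : ℝ) :
    0 ≤ mobiusDeriv q t x :=
  div_nonneg (coeff_det_nonneg hq ht0 ht1) (sq_nonneg _)

theorem ratio_pos (hq : 2 ≤ q) (ht0 : 0 ≤ t) {l : ℝ} (hl : 0 < l) (n : ℕ) :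
    0 < ratio q t l n := by
  induction n with
  | zero => exact hl
  | succ n ih => exact mul_pos hl (pow_pos (mobius_pos hq ht0 ih) 2)

theorem ratioDeriv_nonneg (hq : 2 ≤ q) (ht0 : 0 ≤ t) (ht1 : t ≤ 1) {l : ℝ} (hl : 0 < l)
    (n : ℕ) : 0 ≤ ratioDeriv q t l n := by
  induction n with
  | zero => exact zero_le_one
  | succ n ih =>
    have h1 := (mobius_pos hq ht0 (ratio_pos hq ht0 hl n)).le
    have h2 := mobiusDeriv_nonneg hq ht0 ht1 (ratio q t l n)
    rw [ratioDeriv]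
    positivity

theorem ZZpair_inv_succ_fst (q : ℕ) (t : ℝ) (n : ℕ) (w : ℂ) :
    (ZZpair q t (n + 1) w⁻¹).1 =
      w * ((ZZpair q t n w⁻¹).1 + coeffA q t * (ZZpair q t n w⁻¹).2) ^ 2 := by
  rw [ZZpair, coeffA, inv_inv]
  push_cast
  rfl

theorem ZZpair_inv_succ_snd (q : ℕ) (t : ℝ) (n : ℕ) (w : ℂ) :
    (ZZpair q t (n + 1) w⁻¹).2 =
      (t * (ZZpair q t n w⁻¹).1 + coeffB q t * (ZZpair q t n w⁻¹).2) ^ 2 := by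
  rw [ZZpair, coeffB]
  push_cast
  rfl

theorem differentiable_ZZpair_inv (q : ℕ) (t : ℝ) (n : ℕ) :
    Differentiable ℂ (fun w : ℂ => (ZZpair q t n w⁻¹).1) ∧
      Differentiable ℂ (fun w : ℂ => (ZZpair q t n w⁻¹).2) := by
  induction n with
  | zero =>
    simp only [ZZpair, inv_inv]
    exact ⟨differentiable_id, differentiable_const _⟩
  | succ n ih =>
    obtain ⟨h1, h2⟩ := ih
    simp only [ZZpair_inv_succ_fst, ZZpair_inv_succ_snd]
    exact ⟨by fun_prop, by fun_prop⟩

theorem continuous_Zrooted_inv (q : ℕ) (t : ℝ) (n : ℕ) :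
    Continuous (fun w : ℂ => Zrooted q t n w⁻¹) := by
  obtain ⟨h1, h2⟩ := differentiable_ZZpair_inv q t n
  exact h1.continuous.add (h2.continuous.const_mul _)

/-- One step of the recursion, in terms of the ratio of the two partition functions. -/
theorem ZZpair_inv_succ_of_ratio {n : ℕ} {w u : ℂ}
    (hd : (t : ℂ) * u + coeffB q t ≠ 0)
    (h : (ZZpair q t n w⁻¹).2 ≠ 0 ∧ (ZZpair q t n w⁻¹).1 = u * (ZZpair q t n w⁻¹).2) :
    (ZZpair q t (n + 1) w⁻¹).2 ≠ 0 ∧ (ZZpair q t (n + 1) w⁻¹).1 =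
      w * ((u + coeffA q t) / (t * u + coeffB q t)) ^ 2 * (ZZpair q t (n + 1) w⁻¹).2 := by
  have h2 : (ZZpair q t (n + 1) w⁻¹).2 =
      ((t * u + coeffB q t) * (ZZpair q t n w⁻¹).2) ^ 2 := by
    rw [ZZpair_inv_succ_snd, h.2]
    ring
  refine ⟨h2 ▸ pow_ne_zero 2 (mul_ne_zero hd h.1), ?_⟩
  rw [h2, ZZpair_inv_succ_fst, h.2, mul_pow, div_pow, mul_assoc w, ← mul_assoc (_ / _),
    div_mul_cancel₀ _ (pow_ne_zero 2 hd)]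
  ring

/-- At positive real fields the ratio of the conditional partition functions is `ratio`. -/
theorem ZZpair_inv_ofReal (hq : 2 ≤ q) (ht0 : 0 ≤ t) {l : ℝ} (hl : 0 < l) (n : ℕ) :
    (ZZpair q t n (l : ℂ)⁻¹).2 ≠ 0 ∧
      (ZZpair q t n (l : ℂ)⁻¹).1 = ratio q t l n * (ZZpair q t n (l : ℂ)⁻¹).2 := by
  induction n with
  | zero => simp [ZZpair, ratio]
  | succ n ih =>
    have hd := mobius_denom_pos hq ht0 (ratio_pos hq ht0 hl n).le
    have hd' : (t : ℂ) * ratio q t l n + coeffB q t ≠ 0 := by exact_mod_cast hd.ne'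
    refine ⟨(ZZpair_inv_succ_of_ratio hd' ih).1, ?_⟩
    rw [(ZZpair_inv_succ_of_ratio hd' ih).2, ratio, mobius]
    push_cast
    rfl

theorem Zrooted_eq_of_ratio {n : ℕ} {z u : ℂ}
    (h : (ZZpair q t n z).1 = u * (ZZpair q t n z).2) :
    Zrooted q t n z = (u + ((q : ℂ) - 1)) * (ZZpair q t n z).2 := by
  rw [Zrooted, h]
  ring

theorem Zrooted_ne_zero_of_ratio (hq : 2 ≤ q) {n : ℕ} {z u : ℂ} (hu : -1 < u.re)
    (h : (ZZpair q t n z).2 ≠ 0 ∧ (ZZpair q t n z).1 = u * (ZZpair q t n z).2) :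
    Zrooted q t n z ≠ 0 := by
  rw [Zrooted_eq_of_ratio h.2]
  refine mul_ne_zero (fun h0 => ?_) h.1
  have := congrArg Complex.re h0
  simp only [Complex.add_re, Complex.sub_re, Complex.natCast_re, Complex.one_re,
    Complex.zero_re] at this
  linarith [one_le_cast_sub_one hq]

theorem Zrooted_inv_ofReal_ne_zero (hq : 2 ≤ q) (ht0 : 0 ≤ t) {l : ℝ} (hl : 0 < l) (n : ℕ) :
    Zrooted q t n (l : ℂ)⁻¹ ≠ 0 :=
  Zrooted_ne_zero_of_ratio hq
    (by rw [Complex.ofReal_re]; linarith [ratio_pos hq ht0 hl n])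
    (ZZpair_inv_ofReal hq ht0 hl n)

/-- Membership in `BLY`, in terms of the coordinate `w = z⁻¹`. -/
theorem inv_notMem_BLY_iff {l : ℂ} (hl : l ≠ 0) :
    l⁻¹ ∉ BLY t q ↔ ∀ᶠ w in 𝓝 l, ∀ n, Zrooted q t n w⁻¹ ≠ 0 := by
  rw [BLY, mem_closure_iff_frequently, not_frequently]
  constructor
  · intro h
    have hinv : Tendsto (fun w : ℂ => w⁻¹) (𝓝 l) (𝓝 l⁻¹) := tendsto_inv₀ hl
    filter_upwards [hinv.eventually h, eventually_ne_nhds hl] with w hw hw0 n hn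
    exact hw ⟨inv_ne_zero hw0, n, hn⟩
  · intro h
    have hinv : Tendsto (fun w : ℂ => w⁻¹) (𝓝 l⁻¹) (𝓝 l) := by
      simpa using tendsto_inv₀ (inv_ne_zero hl)
    filter_upwards [hinv.eventually h] with z hz
    rintro ⟨-, n, hn⟩
    exact hz n (by rwa [inv_inv])

/-- The ratios converge only to fixed points of the recursion. -/
theorem eq_of_tendsto_ratio (hq : 2 ≤ q) (ht0 : 0 ≤ t) {l p : ℝ} (hp : 0 ≤ p)
    (h : Tendsto (ratio q t l) atTop (𝓝 p)) : p = l * mobius q t p ^ 2 := by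
  have hd := (mobius_denom_pos hq ht0 hp).ne'
  have hc : ContinuousAt (fun x => l * mobius q t x ^ 2) p := by
    unfold mobius
    fun_prop (disch := assumption)
  exact tendsto_nhds_unique ((tendsto_add_atTop_iff_nat 1).mpr h) (hc.tendsto.comp h)

end Basic

section Attracting

variable {q : ℕ} {t : ℝ}

/-- If the orbit of ratios converges to an attracting fixed point, there are no zeros nearby. -/
theorem inv_notMem_BLY_of_attracting (hq : 2 ≤ q) (ht0 : 0 ≤ t) (ht1 : t ≤ 1)
    {l p : ℝ} (hl : 0 < l) (hp : 0 < p) (hlim : Tendsto (ratio q t l) atTop (𝓝 p))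
    (hmult : 2 * l * mobius q t p * mobiusDeriv q t p < 1) :
    ((l⁻¹ : ℝ) : ℂ) ∉ BLY t q := by
  have hlC : (l : ℂ) ≠ 0 := Complex.ofReal_ne_zero.mpr hl.ne'
  have hfix := eq_of_tendsto_ratio hq ht0 hp.le hlim
  have hdp := mobius_denom_pos hq ht0 hp.le
  have hdpC : (t : ℂ) * p + coeffB q t ≠ 0 := by exact_mod_cast hdp.ne'
  have hb := one_le_coeffB hq ht0
  set a := coeffA q t
  set b := coeffB q t
  set k : ℂ → ℂ := fun u => l * ((u + a) / (t * u + b) + (p + a) / (t * p + b)) *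
    (b - a * t) / ((t * u + b) * (t * p + b)) with hk
  have hkc : ContinuousAt k p := by
    have : ((t : ℂ) * p + b) * (t * p + b) ≠ 0 := mul_ne_zero hdpC hdpC
    simp only [hk]
    fun_prop (disch := assumption)
  have hkp : k p = ((2 * l * mobius q t p * mobiusDeriv q t p : ℝ) : ℂ) := by
    simp only [hk, mobius, mobiusDeriv]
    push_cast
    field_simp
    ring
  set m := 2 * l * mobius q t p * mobiusDeriv q t p with hm
  have hm0 : 0 ≤ m := by
    have h1 := mobius_pos hq ht0 hp
    have h2 := mobiusDeriv_nonneg hq ht0 ht1 p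
    positivity
  have hknorm : ∀ᶠ u in 𝓝 (p : ℂ), ‖k u‖ < (1 + m) / 2 := by
    refine hkc.norm.eventually_lt continuousAt_const ?_
    rw [hkp, Complex.norm_real, Real.norm_of_nonneg hm0]
    linarith
  obtain ⟨r₀, hr₀, hball⟩ := Metric.eventually_nhds_iff_ball.mp hknorm
  set r := min (r₀ / 2) (1 / 2)
  have hr : 0 < r := by positivity
  have hrr : r < r₀ := lt_of_le_of_lt (min_le_left _ _) (by linarith)
  have hr2 : r ≤ 1 / 2 := min_le_right _ _
  have hre : ∀ u ∈ closedBall (p : ℂ) r, -(1 / 2) ≤ u.re := by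
    intro u hu
    rw [mem_closedBall, dist_eq_norm] at hu
    have := (abs_le.mp ((Complex.abs_re_le_norm (u - p)).trans hu)).1
    simp only [Complex.sub_re, Complex.ofReal_re] at this
    linarith
  have hden : ∀ u ∈ closedBall (p : ℂ) r, (t : ℂ) * u + b ≠ 0 := by
    intro u hu h0
    have := congrArg Complex.re h0
    simp only [Complex.add_re, Complex.mul_re, Complex.ofReal_re, Complex.ofReal_im, zero_mul,
      sub_zero, Complex.zero_re] at this
    nlinarith [hre u hu]
  have hstep : ∀ u ∈ closedBall (p : ℂ) r,
      ‖l * ((u + a) / (t * u + b)) ^ 2 - p‖ ≤ (1 + m) / 2 * r := by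
    intro u hu
    have hfixC : (p : ℂ) = l * ((p + a) / (t * p + b)) ^ 2 := by
      rw [mobius] at hfix
      exact_mod_cast hfix
    have hd := hden u hu
    have hd' : u * t + b ≠ 0 := by rwa [mul_comm]
    have hdp' : (p : ℂ) * t + b ≠ 0 := by rwa [mul_comm]
    have : l * ((u + a) / (t * u + b)) ^ 2 - p = k u * (u - p) := by
      conv_lhs => rw [hfixC]
      simp only [hk]
      field_simp
      ring
    rw [this, norm_mul]
    rw [mem_closedBall, dist_eq_norm] at hu
    have := hball u (by rw [mem_ball, dist_eq_norm]; linarith)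
    gcongr
  have hinv : ∀ᶠ w in 𝓝 (l : ℂ), ∀ u ∈ closedBall (p : ℂ) r,
      w * ((u + a) / (t * u + b)) ^ 2 ∈ closedBall (p : ℂ) r := by
    have hδ : 0 < (1 - m) / 2 * r * l / (p + r) := by
      have : 0 < 1 - m := by linarith
      positivity
    filter_upwards [ball_mem_nhds (l : ℂ) hδ] with w hw u hu
    rw [mem_ball, dist_eq_norm, lt_div_iff₀ (by positivity)] at hw
    have h1 := hstep u hu
    set v := ((u + a) / (t * u + b)) ^ 2
    have h2 : l * ‖v‖ ≤ p + r := by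
      have h3 := norm_le_norm_add_norm_sub' (l * v) p
      rw [norm_mul, Complex.norm_real, Complex.norm_real, Real.norm_of_nonneg hl.le,
        Real.norm_of_nonneg hp.le] at h3
      nlinarith
    rw [mem_closedBall, dist_eq_norm, show w * v - p = (w - l) * v + (l * v - p) by ring]
    refine (norm_add_le _ _).trans ?_
    rw [norm_mul]
    have h4 : l * (‖w - l‖ * ‖v‖) ≤ l * ((1 - m) / 2 * r) := by
      calc l * (‖w - l‖ * ‖v‖) = ‖w - l‖ * (l * ‖v‖) := by ring
        _ ≤ ‖w - l‖ * (p + r) := by gcongr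
        _ ≤ l * ((1 - m) / 2 * r) := by linarith
    have h5 := le_of_mul_le_mul_left h4 hl
    linarith
  obtain ⟨N, hN⟩ := Metric.tendsto_atTop.mp hlim r hr
  obtain ⟨hreal1, hreal2⟩ := ZZpair_inv_ofReal hq ht0 hl N
  obtain ⟨hd1, hd2⟩ := differentiable_ZZpair_inv q t N
  have hN2 : ∀ᶠ w in 𝓝 (l : ℂ), (ZZpair q t N w⁻¹).2 ≠ 0 :=
    hd2.continuous.continuousAt.eventually_ne hreal1
  have hN1 : ∀ᶠ w in 𝓝 (l : ℂ),
      (ZZpair q t N w⁻¹).1 / (ZZpair q t N w⁻¹).2 ∈ ball (p : ℂ) r := by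
    refine (hd1.continuous.continuousAt.div hd2.continuous.continuousAt hreal1).eventually_mem
      (isOpen_ball.mem_nhds ?_)
    rw [Pi.div_apply, hreal2, mul_div_cancel_right₀ _ hreal1, mem_ball,
      Complex.dist_of_im_eq (by simp)]
    simpa using hN N le_rfl
  have hfin : ∀ᶠ w in 𝓝 (l : ℂ), ∀ n ∈ Finset.range N, Zrooted q t n w⁻¹ ≠ 0 := by
    rw [Filter.eventually_all_finset]
    intro n _
    exact (continuous_Zrooted_inv q t n).continuousAt.eventually_ne
      (Zrooted_inv_ofReal_ne_zero hq ht0 hl n)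
  rw [Complex.ofReal_inv, inv_notMem_BLY_iff hlC]
  filter_upwards [hinv, hN2, hN1, hfin] with w hw hw2 hw1 hwfin n
  rcases lt_or_ge n N with hn | hn
  · exact hwfin n (Finset.mem_range.mpr hn)
  · have key : ∃ u ∈ closedBall (p : ℂ) r, (ZZpair q t n w⁻¹).2 ≠ 0 ∧
        (ZZpair q t n w⁻¹).1 = u * (ZZpair q t n w⁻¹).2 := by
      induction n, hn using Nat.le_induction with
      | base => exact ⟨_, ball_subset_closedBall hw1, hw2, (div_mul_cancel₀ _ hw2).symm⟩
      | succ n hn ih =>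
        obtain ⟨u, hu, h⟩ := ih
        exact ⟨_, hw u hu, ZZpair_inv_succ_of_ratio (hden u hu) h⟩
    obtain ⟨u, hu, h⟩ := key
    exact Zrooted_ne_zero_of_ratio hq (by linarith [hre u hu]) h

end Attracting

section Repelling

variable {q : ℕ} {t : ℝ}

/-- Along an orbit converging to a fixed point which is not attracting, the derivatives of the
ratios with respect to the parameter are unbounded. -/
theorem not_bddAbove_ratioDeriv (hq : 2 ≤ q) (ht0 : 0 ≤ t) (ht1 : t ≤ 1) {l p : ℝ}
    (hl : 0 < l) (hp : 0 < p) (hlim : Tendsto (ratio q t l) atTop (𝓝 p))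
    (hmult : 1 ≤ 2 * l * mobius q t p * mobiusDeriv q t p) (M : ℝ) :
    ¬∀ n, ratioDeriv q t l n ≤ M := by
  intro hM
  have hd := (mobius_denom_pos hq ht0 hp.le).ne'
  have hd2 := pow_ne_zero 2 hd
  have hcv : ContinuousAt (mobius q t) p := by
    unfold mobius
    fun_prop (disch := assumption)
  have hcw : ContinuousAt (mobiusDeriv q t) p := by
    unfold mobiusDeriv
    fun_prop (disch := assumption)
  have hvp := mobius_pos hq ht0 hp
  have hM0 : 1 ≤ M := hM 0
  set c := mobius q t p ^ 2 / 2 with hc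
  have hc0 : 0 < c := by positivity
  have h1 : ∀ᶠ x in 𝓝 p, c < mobius q t x ^ 2 :=
    continuousAt_const.eventually_lt (hcv.pow 2) (by simp only [hc]; nlinarith)
  have h2 : ∀ᶠ x in 𝓝 p, 1 - c / (2 * M) < 2 * l * mobius q t x * mobiusDeriv q t x := by
    refine continuousAt_const.eventually_lt ((hcv.const_mul (2 * l)).mul hcw) ?_
    have : 0 < c / (2 * M) := by positivity
    linarith
  obtain ⟨N, hN⟩ := eventually_atTop.mp (hlim.eventually (h1.and h2))
  have hgrow : ∀ k : ℕ, k * (c / 2) ≤ ratioDeriv q t l (N + k) := by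
    intro k
    induction k with
    | zero => simpa using ratioDeriv_nonneg hq ht0 ht1 hl N
    | succ k ih =>
      obtain ⟨g1, g2⟩ := hN (N + k) (by omega)
      have hnn := ratioDeriv_nonneg hq ht0 ht1 hl (N + k)
      have hle := hM (N + k)
      have g3 : (1 - c / (2 * M)) * ratioDeriv q t l (N + k) ≤
          2 * l * mobius q t (ratio q t l (N + k)) * mobiusDeriv q t (ratio q t l (N + k)) *
            ratioDeriv q t l (N + k) := by gcongr
      have g4 : c / (2 * M) * ratioDeriv q t l (N + k) ≤ c / 2 := by
        calc c / (2 * M) * ratioDeriv q t l (N + k) ≤ c / (2 * M) * M := by gcongr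
          _ = c / 2 := by field_simp
      rw [← add_assoc, ratioDeriv]
      push_cast
      nlinarith
  obtain ⟨k, hk⟩ := exists_nat_gt (M / (c / 2))
  rw [div_lt_iff₀ (by positivity)] at hk
  linarith [hgrow k, hM (N + k)]

theorem hasDerivAt_ratio (hq : 2 ≤ q) (ht0 : 0 ≤ t) {l : ℝ} (hl : 0 < l) (n : ℕ) :
    HasDerivAt (fun w : ℂ => (ZZpair q t n w⁻¹).1 / (ZZpair q t n w⁻¹).2)
      (ratioDeriv q t l n) l := by
  induction n with
  | zero =>
    simp only [ZZpair, inv_inv, div_one, ratioDeriv, Complex.ofReal_one]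
    exact hasDerivAt_id _
  | succ n ih =>
    obtain ⟨h1, h2⟩ := ZZpair_inv_ofReal hq ht0 hl n
    have hd := mobius_denom_pos hq ht0 (ratio_pos hq ht0 hl n).le
    have hdC : (t : ℂ) * ratio q t l n + coeffB q t ≠ 0 := by exact_mod_cast hd.ne'
    set r : ℂ → ℂ := fun w => (ZZpair q t n w⁻¹).1 / (ZZpair q t n w⁻¹).2 with hr
    have hrl : r l = ratio q t l n := by
      simp only [hr]
      rw [h2, mul_div_cancel_right₀ _ h1]
    have hdr : (t : ℂ) * r l + coeffB q t ≠ 0 := by rwa [hrl]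
    have hder := ((hasDerivAt_id (l : ℂ)).mul
      (((ih.add_const (coeffA q t : ℂ)).div
        ((ih.const_mul (t : ℂ)).add_const (coeffB q t : ℂ)) hdr).pow 2))
    have hev1 : ∀ᶠ w in 𝓝 (l : ℂ), (ZZpair q t n w⁻¹).2 ≠ 0 :=
      (differentiable_ZZpair_inv q t n).2.continuous.continuousAt.eventually_ne h1
    have hev2 : ∀ᶠ w in 𝓝 (l : ℂ), (t : ℂ) * r w + coeffB q t ≠ 0 :=
      ((ih.continuousAt.const_mul (t : ℂ)).add_const (coeffB q t : ℂ)).eventually_ne hdr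
    refine (hder.congr_of_eventuallyEq ?_).congr_deriv ?_
    · filter_upwards [hev1, hev2] with w hw1 hw2
      obtain ⟨g1, g2⟩ := ZZpair_inv_succ_of_ratio hw2 ⟨hw1, (div_mul_cancel₀ _ hw1).symm⟩
      rw [g2, mul_div_cancel_right₀ _ g1]
      rfl
    · have hdC' : (ratio q t l n : ℂ) * t + coeffB q t ≠ 0 := by rwa [mul_comm]
      simp only [id_eq, Pi.pow_apply, Pi.div_apply, hrl, ratioDeriv, mobius, mobiusDeriv]
      push_cast
      field_simp
      ring

/-- The value and the logarithmic derivative of a product of two Cayley transforms at a real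
point. -/
theorem hasDerivAt_cayley_mul {Y : ℂ → ℂ} {y y' κ σ : ℝ} (hκ : 0 < κ)
    (hY : HasDerivAt Y (y' : ℂ) σ) (hy : Y σ = y) {F : ℂ → ℂ}
    (hF : F = fun s => ((Y s + κ * Complex.I) * (s * κ + Complex.I)) /
      ((Y s - κ * Complex.I) * (s * κ - Complex.I))) :
    ‖F σ‖ = 1 ∧ HasDerivAt F (F σ * (-2 * κ * Complex.I) *
      ((y' / (y ^ 2 + κ ^ 2) + 1 / (σ ^ 2 * κ ^ 2 + 1) : ℝ) : ℂ)) σ := by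
  have hne : ∀ x c : ℝ, c ≠ 0 → (x : ℂ) + c * Complex.I ≠ 0 ∧ (x : ℂ) - c * Complex.I ≠ 0 := by
    intro x c hc
    constructor <;> intro h <;> simpa [hc] using congrArg Complex.im h
  obtain ⟨h1, h2⟩ := hne y κ hκ.ne'
  have h34 := hne (σ * κ) 1 one_ne_zero
  push_cast at h34
  rw [one_mul] at h34
  obtain ⟨h3, h4⟩ := h34
  have hnorm : ∀ x c : ℝ, ‖(x : ℂ) + c * Complex.I‖ = ‖(x : ℂ) - c * Complex.I‖ := by
    intro x c
    rw [← Complex.norm_conj]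
    simp [sub_eq_add_neg]
  have hval : F σ = ((y + κ * Complex.I) * (σ * κ + Complex.I)) /
      ((y - κ * Complex.I) * (σ * κ - Complex.I)) := by rw [hF, ← hy]
  constructor
  · have e1 := hnorm y κ
    have e2 := hnorm (σ * κ) 1
    push_cast at e2
    rw [one_mul] at e2
    rw [hval, norm_div, norm_mul, norm_mul, e1, e2]
    exact div_self (mul_ne_zero (norm_ne_zero_iff.mpr h2) (norm_ne_zero_iff.mpr h4))
  · rw [hval, hF]
    have hid := (hasDerivAt_id (σ : ℂ)).mul_const (κ : ℂ)
    have hden : (Y σ - κ * Complex.I) * (id (σ : ℂ) * κ - Complex.I) ≠ 0 := by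
      rw [hy]
      exact mul_ne_zero h2 h4
    refine (((hY.add_const _).mul (hid.add_const _)).div
      ((hY.sub_const _).mul (hid.sub_const _)) hden).congr_deriv ?_
    have e1 : (y : ℂ) ^ 2 + κ ^ 2 = (y + κ * Complex.I) * (y - κ * Complex.I) := by
      linear_combination (κ : ℂ) ^ 2 * Complex.I_sq
    have e2 : (σ : ℂ) ^ 2 * κ ^ 2 + 1 = (σ * κ + Complex.I) * (σ * κ - Complex.I) := by
      linear_combination Complex.I_sq
    simp only [hy, id_eq, Pi.mul_apply]
    push_cast
    rw [e1, e2]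
    field_simp
    ring

/-- If the orbit of ratios converges to a fixed point which is not attracting, zeros accumulate:
otherwise the cross ratios below would contradict Landau's theorem. -/
theorem inv_mem_BLY_of_not_attracting (hq : 2 ≤ q) (ht0 : 0 ≤ t) (ht1 : t ≤ 1) {l p : ℝ}
    (hl : 0 < l) (hp : 0 < p) (hlim : Tendsto (ratio q t l) atTop (𝓝 p))
    (hmult : 1 ≤ 2 * l * mobius q t p * mobiusDeriv q t p) :
    ((l⁻¹ : ℝ) : ℂ) ∈ BLY t q := by
  by_contra hnot
  rw [Complex.ofReal_inv, inv_notMem_BLY_iff (Complex.ofReal_ne_zero.mpr hl.ne')] at hnot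
  set σ := √l with hσ
  have hσ0 : 0 < σ := Real.sqrt_pos.mpr hl
  have hσ2 : σ ^ 2 = l := Real.sq_sqrt hl.le
  have hσC : (σ : ℂ) ^ 2 = l := by exact_mod_cast hσ2
  set κ := √((q : ℝ) - 1) with hκ
  have hq1 := one_le_cast_sub_one hq
  have hκ0 : 0 < κ := Real.sqrt_pos.mpr (by linarith)
  have hκ2 : κ ^ 2 = (q : ℝ) - 1 := Real.sq_sqrt (by linarith)
  have hκC : (κ : ℂ) ^ 2 = (q : ℂ) - 1 := by
    have := congrArg (fun x : ℝ => (x : ℂ)) hκ2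
    push_cast at this
    exact this
  set A : ℕ → ℂ → ℂ := fun n s =>
    (ZZpair q t n (s ^ 2)⁻¹).1 + coeffA q t * (ZZpair q t n (s ^ 2)⁻¹).2 with hA
  set B : ℕ → ℂ → ℂ := fun n s =>
    t * (ZZpair q t n (s ^ 2)⁻¹).1 + coeffB q t * (ZZpair q t n (s ^ 2)⁻¹).2 with hB
  set E : ℕ → ℂ → ℂ := fun n s =>
    ((s * A n s + κ * Complex.I * B n s) * (s * κ + Complex.I)) /
      ((s * A n s - κ * Complex.I * B n s) * (s * κ - Complex.I)) with hE
  have hnhd : ∀ᶠ s in 𝓝 (σ : ℂ), (∀ n, Zrooted q t n (s ^ 2)⁻¹ ≠ 0) ∧ 0 < s.re := by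
    have h1 : Tendsto (fun s : ℂ => s ^ 2) (𝓝 (σ : ℂ)) (𝓝 (l : ℂ)) := by
      have : ContinuousAt (fun s : ℂ => s ^ 2) σ := by fun_prop
      rw [← hσC]
      exact this
    refine (h1.eventually hnot).and ?_
    exact continuousAt_const.eventually_lt Complex.continuous_re.continuousAt
      (by simpa using hσ0)
  obtain ⟨R, hR, hball⟩ := Metric.eventually_nhds_iff_ball.mp hnhd
  have hprod : ∀ n s, (s * A n s + κ * Complex.I * B n s) * (s * A n s - κ * Complex.I * B n s) =
      Zrooted q t (n + 1) (s ^ 2)⁻¹ := by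
    intro n s
    rw [Zrooted, ZZpair_inv_succ_fst, ZZpair_inv_succ_snd, ← hκC]
    simp only [hA, hB]
    linear_combination (-(κ : ℂ) ^ 2 * B n s ^ 2) * Complex.I_sq
  have hfac : ∀ s : ℂ, 0 < s.re → s * κ + Complex.I ≠ 0 ∧ s * κ - Complex.I ≠ 0 := by
    intro s hs
    constructor <;> intro h0
    all_goals
      have := congrArg Complex.re h0
      simp only [Complex.add_re, Complex.sub_re, Complex.mul_re, Complex.ofReal_re,
        Complex.ofReal_im, mul_zero, sub_zero, Complex.I_re, add_zero, Complex.zero_re] at this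
      exact absurd this (mul_pos hs hκ0).ne'
  have hnum : ∀ n, ∀ s ∈ ball (σ : ℂ) R, s * A n s + κ * Complex.I * B n s ≠ 0 := fun n s hs =>
    left_ne_zero_of_mul (hprod n s ▸ (hball s hs).1 (n + 1))
  have hden : ∀ n, ∀ s ∈ ball (σ : ℂ) R, s * A n s - κ * Complex.I * B n s ≠ 0 := fun n s hs =>
    right_ne_zero_of_mul (hprod n s ▸ (hball s hs).1 (n + 1))
  have hdiff : ∀ n, DifferentiableOn ℂ (E n) (ball (σ : ℂ) R) := by
    intro n
    obtain ⟨h1, h2⟩ := differentiable_ZZpair_inv q t n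
    have hsq : Differentiable ℂ (fun s : ℂ => s ^ 2) := by fun_prop
    have h3 : Differentiable ℂ (fun s : ℂ => (ZZpair q t n (s ^ 2)⁻¹).1) := h1.comp hsq
    have h4 : Differentiable ℂ (fun s : ℂ => (ZZpair q t n (s ^ 2)⁻¹).2) := h2.comp hsq
    have hAd : Differentiable ℂ (A n) := h3.add (h4.const_mul _)
    have hBd : Differentiable ℂ (B n) := (h3.const_mul _).add (h4.const_mul _)
    refine DifferentiableOn.div (by fun_prop) (by fun_prop) ?_
    exact fun s hs => mul_ne_zero (hden n s hs) (hfac s (hball s hs).2).2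
  have hE0 : ∀ n, ∀ s ∈ ball (σ : ℂ) R, E n s ≠ 0 := fun n s hs =>
    div_ne_zero (mul_ne_zero (hnum n s hs) (hfac s (hball s hs).2).1)
      (mul_ne_zero (hden n s hs) (hfac s (hball s hs).2).2)
  have hE1 : ∀ n, ∀ s ∈ ball (σ : ℂ) R, E n s ≠ 1 := by
    intro n s hs h1
    have hs0 : s ≠ 0 := fun h => by simpa [h] using (hball s hs).2
    rw [hE, div_eq_one_iff_eq
      (mul_ne_zero (hden n s hs) (hfac s (hball s hs).2).2)] at h1
    have hsum : 2 * Complex.I * s * (1 + coeffA q t) * Zrooted q t n (s ^ 2)⁻¹ = 0 := by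
      have hcast : (coeffA q t : ℂ) = (κ : ℂ) ^ 2 * t := by
        rw [hκC, coeffA]; push_cast; ring
      have hcast' : (coeffB q t : ℂ) = 1 + ((κ : ℂ) ^ 2 - 1) * t := by
        rw [hκC, coeffB]; push_cast; ring
      rw [Zrooted, ← hκC]
      simp only [hA, hB, hcast, hcast'] at h1 ⊢
      linear_combination h1
    have ha : (1 : ℂ) + coeffA q t ≠ 0 := by
      have := coeffA_nonneg hq ht0
      exact_mod_cast (by linarith : (1 : ℝ) + coeffA q t ≠ 0)
    exact mul_ne_zero (mul_ne_zero (mul_ne_zero (mul_ne_zero two_ne_zero Complex.I_ne_zero) hs0) ha)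
      ((hball s hs).1 n) hsum
  set d : ℕ → ℝ := fun n => mobius q t (ratio q t l n) +
    2 * l * mobiusDeriv q t (ratio q t l n) * ratioDeriv q t l n with hd
  have hcayley : ∀ n, ‖E n σ‖ = 1 ∧ HasDerivAt (E n) (E n σ * (-2 * κ * Complex.I) *
      ((d n / ((σ * mobius q t (ratio q t l n)) ^ 2 + κ ^ 2) +
        1 / (σ ^ 2 * κ ^ 2 + 1) : ℝ) : ℂ)) σ := by
    intro n
    obtain ⟨hz, hrat⟩ := ZZpair_inv_ofReal hq ht0 hl n
    rw [← hσC] at hz hrat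
    have hdC : (t : ℂ) * ratio q t l n + coeffB q t ≠ 0 := by
      exact_mod_cast (mobius_denom_pos hq ht0 (ratio_pos hq ht0 hl n).le).ne'
    set r : ℂ → ℂ := fun s => (ZZpair q t n (s ^ 2)⁻¹).1 / (ZZpair q t n (s ^ 2)⁻¹).2 with hr
    have hrσ : r σ = ratio q t l n := by
      simp only [hr]
      rw [hrat, mul_div_cancel_right₀ _ hz]
    have hdr : (t : ℂ) * r σ + coeffB q t ≠ 0 := by rwa [hrσ]
    have hrd : HasDerivAt r (ratioDeriv q t l n * (2 * σ)) σ := by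
      have h1 := hasDerivAt_ratio hq ht0 hl n
      rw [← hσC] at h1
      have h2 : HasDerivAt (fun s : ℂ => s ^ 2) (2 * (σ : ℂ)) σ := by
        simpa using hasDerivAt_pow 2 (σ : ℂ)
      exact HasDerivAt.comp (σ : ℂ) h1 h2
    set Y : ℂ → ℂ := fun s => s * ((r s + coeffA q t) / (t * r s + coeffB q t)) with hY
    have hYd : HasDerivAt Y (d n : ℂ) σ := by
      have h1 := (hasDerivAt_id (σ : ℂ)).mul ((hrd.add_const (coeffA q t : ℂ)).div
        ((hrd.const_mul (t : ℂ)).add_const (coeffB q t : ℂ)) hdr)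
      refine h1.congr_deriv ?_
      have hdC' : (ratio q t l n : ℂ) * t + coeffB q t ≠ 0 := by rwa [mul_comm]
      simp only [id_eq, Pi.div_apply, hrσ, hd, mobius, mobiusDeriv]
      push_cast
      rw [← hσC]
      field_simp
      ring
    have hYσ : Y σ = ((σ * mobius q t (ratio q t l n) : ℝ) : ℂ) := by
      simp only [hY, hrσ, mobius]
      push_cast
      rfl
    obtain ⟨g1, g2⟩ := hasDerivAt_cayley_mul hκ0 hYd hYσ rfl
    have hev1 : ∀ᶠ s in 𝓝 (σ : ℂ), (ZZpair q t n (s ^ 2)⁻¹).2 ≠ 0 := by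
      refine ContinuousAt.eventually_ne ?_ hz
      have hsq : Continuous (fun s : ℂ => s ^ 2) := by fun_prop
      exact ((differentiable_ZZpair_inv q t n).2.continuous.comp hsq).continuousAt
    have hev2 : ∀ᶠ s in 𝓝 (σ : ℂ), (t : ℂ) * r s + coeffB q t ≠ 0 :=
      ((hrd.continuousAt.const_mul (t : ℂ)).add_const (coeffB q t : ℂ)).eventually_ne hdr
    have heq : E n =ᶠ[𝓝 (σ : ℂ)] fun s => ((Y s + κ * Complex.I) * (s * κ + Complex.I)) /
        ((Y s - κ * Complex.I) * (s * κ - Complex.I)) := by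
      filter_upwards [hev1, hev2] with s hs1 hs2
      have hAs : s * A n s = Y s * (t * r s + coeffB q t) * (ZZpair q t n (s ^ 2)⁻¹).2 := by
        simp only [hA, hY]
        rw [mul_assoc s, div_mul_cancel₀ _ hs2, mul_assoc, add_mul, hr, div_mul_cancel₀ _ hs1]
      have hBs : B n s = (t * r s + coeffB q t) * (ZZpair q t n (s ^ 2)⁻¹).2 := by
        simp only [hB]
        rw [add_mul, mul_assoc, hr, div_mul_cancel₀ _ hs1]
      have hc := mul_ne_zero hs2 hs1
      simp only [hE]
      rw [hAs, hBs]
      conv_rhs => rw [← mul_div_mul_left _ _ hc]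
      congr 1 <;> ring
    rw [← heq.eq_of_nhds] at g1 g2
    exact ⟨g1, g2.congr_of_eventuallyEq heq⟩
  obtain ⟨V, hV⟩ : ∃ V, ∀ n, mobius q t (ratio q t l n) ^ 2 ≤ V := by
    obtain ⟨V, hV⟩ := hlim.bddAbove_range
    refine ⟨V / l, fun n => ?_⟩
    rw [le_div_iff₀ hl, mul_comm]
    exact hV ⟨n + 1, rfl⟩
  set C := 2 * Real.pi * (960 / R)
  have hdle : ∀ n, d n ≤ C / (2 * κ) * (l * V + κ ^ 2) := by
    intro n
    obtain ⟨g1, g2⟩ := hcayley n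
    have h1 := landau hR (hdiff n) (hE0 n) (hE1 n) g1
    have hdn : 0 ≤ d n := by
      have h2 := mobius_pos hq ht0 (ratio_pos hq ht0 hl n)
      have h3 := mobiusDeriv_nonneg hq ht0 ht1 (ratio q t l n)
      have h4 := ratioDeriv_nonneg hq ht0 ht1 hl n
      simp only [hd]
      positivity
    have hY2 : (σ * mobius q t (ratio q t l n)) ^ 2 ≤ l * V := by
      rw [mul_pow, hσ2]
      exact mul_le_mul_of_nonneg_left (hV n) hl.le
    set y := σ * mobius q t (ratio q t l n)
    rw [g2.deriv, norm_mul, norm_mul, g1, Complex.norm_real, Real.norm_of_nonneg (by positivity),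
      norm_mul, norm_mul, Complex.norm_I, Complex.norm_real, Real.norm_of_nonneg hκ0.le, norm_neg,
      Complex.norm_ofNat, one_mul, mul_one] at h1
    have h5 : d n / (y ^ 2 + κ ^ 2) ≤ C / (2 * κ) := by
      rw [le_div_iff₀ (by positivity)]
      have : 0 < 1 / (σ ^ 2 * κ ^ 2 + 1) := by positivity
      nlinarith
    have hpos : 0 < y ^ 2 + κ ^ 2 := by positivity
    rw [div_le_iff₀ hpos] at h5
    refine h5.trans (mul_le_mul_of_nonneg_left (by linarith) ?_)
    positivity
  set D := C / (2 * κ) * (l * V + κ ^ 2)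
  refine not_bddAbove_ratioDeriv hq ht0 ht1 hl hp hlim hmult (max 1 ((1 + V) * D)) fun n => ?_
  rcases n with _ | n
  · exact le_max_left _ _
  · refine le_max_of_le_right ?_
    have h2 := mobius_pos hq ht0 (ratio_pos hq ht0 hl n)
    have h3 : mobius q t (ratio q t l n) ≤ 1 + V := by nlinarith [hV n]
    have h4 : 0 ≤ D := by
      have := mobiusDeriv_nonneg hq ht0 ht1 (ratio q t l n)
      have := ratioDeriv_nonneg hq ht0 ht1 hl n
      refine le_trans ?_ (hdle n)
      simp only [hd]
      positivity
    calc ratioDeriv q t l (n + 1) = mobius q t (ratio q t l n) * d n := rfl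
      _ ≤ mobius q t (ratio q t l n) * D := by gcongr; exact hdle n
      _ ≤ (1 + V) * D := by gcongr

end Repelling

section Dynamics

variable {q : ℕ} {t : ℝ}

theorem mobius_mono (hq : 2 ≤ q) (ht0 : 0 ≤ t) (ht1 : t ≤ 1) {x y : ℝ} (hx : 0 ≤ x)
    (hxy : x ≤ y) : mobius q t x ≤ mobius q t y := by
  rw [mobius, mobius, div_le_div_iff₀ (mobius_denom_pos hq ht0 hx)
    (mobius_denom_pos hq ht0 (hx.trans hxy))]
  linarith [mul_nonneg (coeff_det_nonneg hq ht0 ht1) (sub_nonneg.mpr hxy)]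

theorem mobius_one (hq : 2 ≤ q) (ht0 : 0 ≤ t) : mobius q t 1 = 1 := by
  rw [mobius, div_eq_one_iff_eq (mobius_denom_pos hq ht0 zero_le_one).ne', coeffA, coeffB]
  ring

theorem mul_mobius_le_one (hq : 2 ≤ q) (ht0 : 0 ≤ t) (ht1 : t ≤ 1) {x : ℝ} (hx : 0 ≤ x) :
    t * mobius q t x ≤ 1 := by
  rw [mobius, ← mul_div_assoc, div_le_one (mobius_denom_pos hq ht0 hx)]
  linarith [coeff_det_nonneg hq ht0 ht1]

/-- The recursion of the ratios is monotone. -/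
theorem ratio_step_mono (hq : 2 ≤ q) (ht0 : 0 ≤ t) (ht1 : t ≤ 1) {l x y : ℝ} (hl : 0 < l)
    (hx : 0 < x) (hxy : x ≤ y) : l * mobius q t x ^ 2 ≤ l * mobius q t y ^ 2 := by
  have h1 := mobius_mono hq ht0 ht1 hx.le hxy
  have h2 := (mobius_pos hq ht0 hx).le
  gcongr

/-- For `l > 1` the ratios increase to the smallest fixed point above `1`. -/
theorem exists_tendsto_ratio_of_one_lt (hq : 2 ≤ q) (ht0 : 0 < t) (ht1 : t ≤ 1) {l : ℝ}
    (hl : 1 < l) : ∃ p, 1 < p ∧ Tendsto (ratio q t l) atTop (𝓝 p) ∧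
      ∀ y, 1 ≤ y → l * mobius q t y ^ 2 ≤ y → p ≤ y := by
  have hl0 : 0 < l := by linarith
  have hstep : ∀ n, ratio q t l n ≤ ratio q t l (n + 1) := by
    intro n
    induction n with
    | zero =>
      have := ratio_step_mono hq ht0.le ht1 hl0 one_pos hl.le
      rw [mobius_one hq ht0.le] at this
      simpa [ratio] using this
    | succ n ih => exact ratio_step_mono hq ht0.le ht1 hl0 (ratio_pos hq ht0.le hl0 n) ih
  have hbdd : BddAbove (range (ratio q t l)) := by
    refine ⟨l / t ^ 2, ?_⟩
    rintro _ ⟨n, rfl⟩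
    rw [le_div_iff₀ (by positivity)]
    rcases n with _ | n
    · have : t ^ 2 ≤ 1 := pow_le_one₀ ht0.le ht1
      simp only [ratio]
      nlinarith
    · have hr := ratio_pos hq ht0.le hl0 n
      have h1 := mul_mobius_le_one hq ht0.le ht1 hr.le
      have h2 := mobius_pos hq ht0.le hr
      have h3 : (t * mobius q t (ratio q t l n)) ^ 2 ≤ 1 := pow_le_one₀ (by positivity) h1
      rw [ratio]
      nlinarith
  refine ⟨_, ?_, tendsto_atTop_ciSup (monotone_nat_of_le_succ hstep) hbdd, ?_⟩
  · exact hl.trans_le (le_ciSup hbdd 0)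
  · intro y hy hfy
    refine ciSup_le fun n => ?_
    induction n with
    | zero =>
      have := ratio_step_mono hq ht0.le ht1 hl0 one_pos hy
      rw [mobius_one hq ht0.le] at this
      simp only [ratio]
      linarith
    | succ n ih =>
      exact (ratio_step_mono hq ht0.le ht1 hl0 (ratio_pos hq ht0.le hl0 n) ih).trans hfy

/-- For `l < 1` the ratios decrease to the largest fixed point below `1`. -/
theorem exists_tendsto_ratio_of_lt_one (hq : 2 ≤ q) (ht0 : 0 < t) (ht1 : t ≤ 1) {l : ℝ}
    (hl0 : 0 < l) (hl : l < 1) : ∃ p, 0 < p ∧ p < 1 ∧ Tendsto (ratio q t l) atTop (𝓝 p) ∧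
      ∀ y, 0 < y → y ≤ 1 → y ≤ l * mobius q t y ^ 2 → y ≤ p := by
  have hstep : ∀ n, ratio q t l (n + 1) ≤ ratio q t l n := by
    intro n
    induction n with
    | zero =>
      have := ratio_step_mono hq ht0.le ht1 hl0 hl0 hl.le
      rw [mobius_one hq ht0.le] at this
      simpa [ratio] using this
    | succ n ih => exact ratio_step_mono hq ht0.le ht1 hl0 (ratio_pos hq ht0.le hl0 (n + 1)) ih
  have hm0 : 0 < mobius q t 0 := by
    have h1 := mobius_denom_pos hq ht0.le le_rfl
    have h2 : 0 < coeffA q t := mul_pos (by linarith [one_le_cast_sub_one hq]) ht0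
    exact div_pos (by linarith) h1
  have hlow : ∀ n, l * mobius q t 0 ^ 2 ≤ ratio q t l n := by
    intro n
    rcases n with _ | n
    · have h1 := mobius_mono hq ht0.le ht1 le_rfl zero_le_one
      rw [mobius_one hq ht0.le] at h1
      have h2 : mobius q t 0 ^ 2 ≤ 1 := pow_le_one₀ hm0.le h1
      simp only [ratio]
      nlinarith
    · have h1 := mobius_mono hq ht0.le ht1 le_rfl (ratio_pos hq ht0.le hl0 n).le
      rw [ratio]
      gcongr
  have hbdd : BddBelow (range (ratio q t l)) :=
    ⟨l * mobius q t 0 ^ 2, by rintro _ ⟨n, rfl⟩; exact hlow n⟩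
  refine ⟨_, ?_, ?_, tendsto_atTop_ciInf (antitone_nat_of_succ_le hstep) hbdd, ?_⟩
  · exact lt_of_lt_of_le (by positivity) (le_ciInf hlow)
  · exact (ciInf_le hbdd 0).trans_lt hl
  · intro y hy0 hy hfy
    refine le_ciInf fun n => ?_
    induction n with
    | zero =>
      have := ratio_step_mono hq ht0.le ht1 hl0 hy0 hy
      rw [mobius_one hq ht0.le] at this
      simp only [ratio]
      linarith
    | succ n ih => exact hfy.trans (ratio_step_mono hq ht0.le ht1 hl0 hy0 ih)

/-- A quadratic in `p` with the sign of `1 - m`, where `m` is the multiplier of a fixed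
point `p`. -/
def critPoly (q : ℕ) (t p : ℝ) : ℝ :=
  t * p ^ 2 + (3 * coeffA q t * t - coeffB q t) * p + coeffA q t * coeffB q t

/-- The quotient by `u - p` of the cubic in `u` which detects the sign of `u - f u`,
where `f` is the recursion with fixed point `p`. -/
def cofactor (q : ℕ) (t p u : ℝ) : ℝ :=
  t ^ 2 * (p + coeffA q t) ^ 2 * u ^ 2 +
    (t ^ 2 * p * (p + coeffA q t) ^ 2 + 2 * t * coeffB q t * (p + coeffA q t) ^ 2 -
      p * (t * p + coeffB q t) ^ 2) * u +
    (t * p + coeffB q t) ^ 2 * coeffA q t ^ 2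

theorem one_sub_multiplier (hq : 2 ≤ q) (ht0 : 0 ≤ t) {l p : ℝ} (hp : 0 < p)
    (hfix : p = l * mobius q t p ^ 2) :
    (1 - 2 * l * mobius q t p * mobiusDeriv q t p) *
      ((p + coeffA q t) * (t * p + coeffB q t)) = critPoly q t p := by
  have hd := (mobius_denom_pos hq ht0 hp.le).ne'
  have h : l * mobius q t p * mobiusDeriv q t p * ((p + coeffA q t) * (t * p + coeffB q t)) =
      l * mobius q t p ^ 2 * (coeffB q t - coeffA q t * t) := by
    rw [mobius, mobiusDeriv]
    field_simp
  rw [← hfix] at h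
  rw [critPoly]
  linear_combination -2 * h

theorem cofactor_self (q : ℕ) (t p : ℝ) :
    cofactor q t p p = (p + coeffA q t) * (t * p + coeffB q t) * critPoly q t p := by
  rw [cofactor, critPoly]
  ring

theorem sub_mul_cofactor (hq : 2 ≤ q) (ht0 : 0 ≤ t) {l p u : ℝ} (hp : 0 < p) (hu : 0 < u)
    (hfix : p = l * mobius q t p ^ 2) : (u - p) * cofactor q t p u =
      ((p + coeffA q t) * (t * u + coeffB q t)) ^ 2 * (u - l * mobius q t u ^ 2) := by
  have hd := (mobius_denom_pos hq ht0 hp.le).ne'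
  have hdu := (mobius_denom_pos hq ht0 hu.le).ne'
  have h1 : l * (p + coeffA q t) ^ 2 = p * (t * p + coeffB q t) ^ 2 := by
    rw [mobius, div_pow, ← mul_div_assoc, eq_div_iff (pow_ne_zero 2 hd)] at hfix
    exact hfix.symm
  have h2 : (t * u + coeffB q t) ^ 2 * (l * mobius q t u ^ 2) = l * (u + coeffA q t) ^ 2 := by
    rw [mobius]
    field_simp
  rw [cofactor]
  linear_combination (u + coeffA q t) ^ 2 * h1 + (p + coeffA q t) ^ 2 * h2

theorem mul_cofactor (q : ℕ) (t p u : ℝ) : p * cofactor q t p u =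
    (u - p) * (t ^ 2 * (p + coeffA q t) ^ 2 * p * u - (t * p + coeffB q t) ^ 2 * coeffA q t ^ 2) +
      u * ((p + coeffA q t) * (t * p + coeffB q t) * critPoly q t p) := by
  rw [← cofactor_self, cofactor, cofactor]
  ring

theorem critPoly_one (q : ℕ) (t : ℝ) :
    critPoly q t 1 = (((q : ℝ) + 1) * t - 1) * (((q : ℝ) - 1) * t + 1) := by
  rw [critPoly, coeffA, coeffB]
  ring

theorem multiplier_lt_one_iff (hq : 2 ≤ q) (ht0 : 0 ≤ t) {l p : ℝ} (hp : 0 < p)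
    (hfix : p = l * mobius q t p ^ 2) :
    2 * l * mobius q t p * mobiusDeriv q t p < 1 ↔ 0 < critPoly q t p := by
  have h1 := mobius_denom_pos hq ht0 hp.le
  have h2 : 0 < p + coeffA q t := by linarith [coeffA_nonneg hq ht0]
  rw [← one_sub_multiplier hq ht0 hp hfix, mul_pos_iff_of_pos_right (by positivity), sub_pos]

/-- For `l > 1`, the limit of the ratios is attracting, or it is a double fixed point which is
the smaller root of `critPoly`. -/
theorem attracting_or_critical_of_one_lt (hq : 2 ≤ q) (ht0 : 0 < t) {l p : ℝ}
    (hp : 1 < p) (hfix : p = l * mobius q t p ^ 2)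
    (hmin : ∀ y, 1 ≤ y → l * mobius q t y ^ 2 ≤ y → p ≤ y) :
    0 < critPoly q t p ∨ critPoly q t p = 0 ∧ t * p ^ 2 ≤ coeffA q t * coeffB q t := by
  have hp0 : 0 < p := by linarith
  have ha := coeffA_nonneg hq ht0.le
  have hb := one_le_coeffB hq ht0.le
  have hcl : ∀ g : ℝ → ℝ, Continuous g → (∀ u ∈ Ico 1 p, 0 ≤ g u) → 0 ≤ g p := by
    intro g hg h
    have := closure_minimal (s := Ico 1 p) (t := {u | 0 ≤ g u}) h
      (isClosed_le continuous_const hg)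
    rw [closure_Ico hp.ne] at this
    exact this (right_mem_Icc.mpr hp.le)
  have hK : ∀ u ∈ Ico 1 p, 0 < cofactor q t p u := by
    rintro u ⟨hu1, hup⟩
    have hu0 : 0 < u := by linarith
    have h1 : u - l * mobius q t u ^ 2 < 0 := by
      by_contra! h
      linarith [hmin u hu1 (by linarith)]
    have h2 := sub_mul_cofactor hq ht0.le hp0 hu0 hfix
    have h3 : 0 < (p + coeffA q t) * (t * u + coeffB q t) := by positivity
    have h4 : (u - p) * cofactor q t p u < 0 := by
      rw [h2]
      exact mul_neg_of_pos_of_neg (by positivity) h1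
    exact pos_of_mul_neg_right h4 (by linarith)
  have hpos : 0 < (p + coeffA q t) * (t * p + coeffB q t) := by positivity
  have hQ : 0 ≤ critPoly q t p := by
    have := hcl (cofactor q t p) (by unfold cofactor; fun_prop) fun u hu => (hK u hu).le
    rw [cofactor_self] at this
    exact nonneg_of_mul_nonneg_right this hpos
  rcases hQ.lt_or_eq with h | h
  · exact Or.inl h
  · refine Or.inr ⟨h.symm, ?_⟩
    have h1 := hcl (fun u => (t * p + coeffB q t) ^ 2 * coeffA q t ^ 2 -
      t ^ 2 * (p + coeffA q t) ^ 2 * p * u) (by fun_prop) ?_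
    · have h2 : (t * p * (p + coeffA q t)) ^ 2 ≤ ((t * p + coeffB q t) * coeffA q t) ^ 2 := by
        linarith
      have h3 := le_of_sq_le_sq h2 (by positivity)
      linarith
    · intro u hu
      have h2 := mul_cofactor q t p u
      rw [← h, mul_zero, mul_zero, add_zero] at h2
      have h3 := mul_pos hp0 (hK u hu)
      have h4 : u - p < 0 := by linarith [hu.2]
      rw [h2] at h3
      nlinarith

/-- For `l < 1`, the limit of the ratios is attracting. -/
theorem critPoly_pos_of_lt_one (hq : 2 ≤ q) (ht0 : 0 < t) {l p : ℝ} (hp0 : 0 < p)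
    (hp : p < 1) (hfix : p = l * mobius q t p ^ 2)
    (hmax : ∀ y, 0 < y → y ≤ 1 → y ≤ l * mobius q t y ^ 2 → y ≤ p) :
    0 < critPoly q t p := by
  have ha := coeffA_nonneg hq ht0.le
  have hb := one_le_coeffB hq ht0.le
  have hcl : ∀ g : ℝ → ℝ, Continuous g → (∀ u ∈ Ioc p 1, 0 ≤ g u) → 0 ≤ g p := by
    intro g hg h
    have := closure_minimal (s := Ioc p 1) (t := {u | 0 ≤ g u}) h
      (isClosed_le continuous_const hg)
    rw [closure_Ioc hp.ne] at this
    exact this (left_mem_Icc.mpr hp.le)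
  have hK : ∀ u ∈ Ioc p 1, 0 < cofactor q t p u := by
    rintro u ⟨hup, hu1⟩
    have hu0 : 0 < u := by linarith
    have h1 : 0 < u - l * mobius q t u ^ 2 := by
      by_contra! h
      linarith [hmax u hu0 hu1 (by linarith)]
    have h2 := sub_mul_cofactor hq ht0.le hp0 hu0 hfix
    have h3 : 0 < (p + coeffA q t) * (t * u + coeffB q t) := by positivity
    have h4 : 0 < (u - p) * cofactor q t p u := by
      rw [h2]
      positivity
    exact pos_of_mul_pos_right h4 (by linarith)
  have hpos : 0 < (p + coeffA q t) * (t * p + coeffB q t) := by positivity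
  have hQ : 0 ≤ critPoly q t p := by
    have := hcl (cofactor q t p) (by unfold cofactor; fun_prop) fun u hu => (hK u hu).le
    rw [cofactor_self] at this
    exact nonneg_of_mul_nonneg_right this hpos
  refine hQ.lt_of_ne fun h => ?_
  have h1 := hcl (fun u => t ^ 2 * (p + coeffA q t) ^ 2 * p * u -
    (t * p + coeffB q t) ^ 2 * coeffA q t ^ 2) (by fun_prop) ?_
  · have h2 : ((t * p + coeffB q t) * coeffA q t) ^ 2 ≤ (t * p * (p + coeffA q t)) ^ 2 := by
      linarith
    have h3 := le_of_sq_le_sq h2 (by positivity)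
    have h4 : t * 1 ≤ coeffA q t * coeffB q t := by
      have : t ≤ coeffA q t := by
        rw [coeffA]
        nlinarith [one_le_cast_sub_one hq]
      gcongr
    have h5 : t * p ^ 2 < t * 1 := by
      gcongr
      exact pow_lt_one₀ hp0.le hp two_ne_zero
    linarith
  · intro u hu
    have h2 := mul_cofactor q t p u
    rw [← h, mul_zero, mul_zero, add_zero] at h2
    have h3 := mul_pos hp0 (hK u hu)
    have h4 : 0 < u - p := by linarith [hu.1]
    rw [h2] at h3
    nlinarith

end Dynamics

section Parameters

variable {q : ℕ} {t : ℝ}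

theorem le_tOne_iff (q : ℕ) (t : ℝ) : t ≤ tOne q ↔ ((q : ℝ) + 1) * t ≤ 1 := by
  rw [tOne, le_div_iff₀ (by positivity), add_comm, mul_comm]

theorem le_tTwo_iff (hq : 2 ≤ q) (ht0 : 0 ≤ t) :
    t ≤ tTwo q ↔ 0 ≤ coeffB q t - 9 * coeffA q t * t := by
  have h1 := one_le_cast_sub_one hq
  have hX0 : (0 : ℝ) ≤ (q : ℝ) ^ 2 + 32 * q - 32 := by nlinarith
  have hX := Real.sq_sqrt hX0
  have hXn := Real.sqrt_nonneg ((q : ℝ) ^ 2 + 32 * q - 32)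
  rw [tTwo, le_div_iff₀ (by linarith), coeffA, coeffB]
  set X := √((q : ℝ) ^ 2 + 32 * q - 32)
  have key : 36 * ((q : ℝ) - 1) * (1 + ((q : ℝ) - 2) * t - 9 * (((q : ℝ) - 1) * t) * t) =
      X ^ 2 - (18 * ((q : ℝ) - 1) * t - ((q : ℝ) - 2)) ^ 2 := by
    rw [hX]
    ring
  have hpos : 0 < 36 * ((q : ℝ) - 1) := by linarith
  rw [← mul_nonneg_iff_of_pos_left hpos, key, sub_nonneg]
  constructor
  · intro h
    have h2 : (q : ℝ) - 2 ≤ X := abs_le_of_sq_le_sq' (by nlinarith) hXn |>.2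
    have h3 : 0 ≤ 18 * ((q : ℝ) - 1) * t := by positivity
    exact sq_le_sq' (by linarith) (by linarith)
  · intro h
    have := (abs_le_of_sq_le_sq' h hXn).2
    linarith

/-- At a root of `critPoly`, expressed through a square root `s` of its discriminant,
`calZ` is the field for which this root is a fixed point. -/
theorem calZ_eq (hq : 2 ≤ q) (ht0 : 0 < t) {s p : ℝ} (hs : 0 ≤ s)
    (hs2 : s ^ 2 = (coeffB q t - coeffA q t * t) * (coeffB q t - 9 * coeffA q t * t))
    (h9 : 0 ≤ coeffB q t - 9 * coeffA q t * t)
    (hp : 2 * t * p = coeffB q t - 3 * coeffA q t * t - s) :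
    calZ q t * (p * (t * p + coeffB q t) ^ 2) = (p + coeffA q t) ^ 2 := by
  have hb := one_le_coeffB hq ht0.le
  have hroot : √((t - 1) * (((q : ℝ) - 1) * t + 1) *
      (9 * ((q : ℝ) - 1) * t ^ 2 - ((q : ℝ) - 2) * t - 1) ^ 3) =
      (coeffB q t - 9 * coeffA q t * t) * s := by
    rw [← Real.sqrt_sq (mul_nonneg h9 hs), mul_pow, hs2, coeffA, coeffB]
    congr 1
    ring
  have hnum : -27 * ((q : ℝ) - 1) ^ 2 * t ^ 4 + 18 * ((q : ℝ) ^ 2 - 3 * q + 2) * t ^ 3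
      + ((q : ℝ) ^ 2 + 14 * q - 14) * t ^ 2 + 2 * ((q : ℝ) - 2) * t + 1 =
      coeffB q t ^ 2 + 18 * coeffA q t * coeffB q t * t - 27 * coeffA q t ^ 2 * t ^ 2 := by
    rw [coeffA, coeffB]
    ring
  have hden : 8 * t * (((q : ℝ) - 2) * t + 1) ^ 3 = 8 * t * coeffB q t ^ 3 := by
    rw [coeffB]
    ring
  rw [calZ, hroot, hnum, hden, div_mul_eq_mul_div, div_eq_iff (by positivity)]
  set a := coeffA q t
  set b := coeffB q t
  have hsp : s = b - 3 * a * t - 2 * t * p := by linarith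
  have hQ : t * p ^ 2 = (b - 3 * a * t) * p - a * b := by
    rw [hsp] at hs2
    have : t * (t * p ^ 2 - ((b - 3 * a * t) * p - a * b)) = 0 := by linear_combination hs2 / 4
    rcases mul_eq_zero.mp this with h | h
    · exact absurd h ht0.ne'
    · linarith
  rw [hsp]
  linear_combination 2 * t * (-4 * a * b ^ 2 + (3 * b ^ 2 - 15 * a * b * t) * p +
    (b * t - 9 * a * t ^ 2) * p ^ 2) * hQ

theorem calZ_inv_of_fixed (hq : 2 ≤ q) (ht0 : 0 < t) {l s p : ℝ} (hl : 0 < l) (hp0 : 0 < p)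
    (hs : 0 ≤ s)
    (hs2 : s ^ 2 = (coeffB q t - coeffA q t * t) * (coeffB q t - 9 * coeffA q t * t))
    (h9 : 0 ≤ coeffB q t - 9 * coeffA q t * t)
    (hp : 2 * t * p = coeffB q t - 3 * coeffA q t * t - s)
    (hfix : p = l * mobius q t p ^ 2) : l⁻¹ = calZ q t := by
  have hd := mobius_denom_pos hq ht0.le hp0.le
  have h := calZ_eq hq ht0 hs hs2 h9 hp
  have ha := coeffA_nonneg hq ht0.le
  rw [mobius, div_pow, ← mul_div_assoc, eq_div_iff (pow_ne_zero 2 hd.ne')] at hfix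
  rw [hfix] at h
  rw [inv_eq_one_div, div_eq_iff hl.ne', eq_comm]
  refine mul_right_cancel₀ (b := (p + coeffA q t) ^ 2) (by positivity) ?_
  linarith

theorem calZ_inv_of_critical (hq : 2 ≤ q) (ht0 : 0 < t) {l p : ℝ} (hl : 0 < l)
    (hp : 1 < p) (hfix : p = l * mobius q t p ^ 2) (hQ : critPoly q t p = 0)
    (hab : t * p ^ 2 ≤ coeffA q t * coeffB q t) :
    tOne q < t ∧ t ≤ tTwo q ∧ l⁻¹ = calZ q t := by
  have ha := coeffA_nonneg hq ht0.le
  have hb := one_le_coeffB hq ht0.le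
  have hp0 : 0 < p := by linarith
  have hQ1 := critPoly_one q t
  rw [critPoly] at hQ hQ1
  rw [← not_le, le_tOne_iff, le_tTwo_iff hq ht0.le]
  set a := coeffA q t
  set b := coeffB q t
  have hs : 0 ≤ b - 3 * a * t - 2 * t * p := by
    refine nonneg_of_mul_nonneg_left (b := p) ?_ hp0
    linarith
  have hs2 : (b - 3 * a * t - 2 * t * p) ^ 2 = (b - a * t) * (b - 9 * a * t) := by
    linear_combination 4 * t * hQ
  have hat : 0 ≤ a * t := by positivity
  have htp : 0 < t * p := by positivity
  have h9 : 0 ≤ b - 9 * a * t := by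
    refine nonneg_of_mul_nonneg_right (hs2 ▸ sq_nonneg _) ?_
    linarith
  refine ⟨fun h => ?_, h9, calZ_inv_of_fixed hq ht0 hl hp0 hs hs2 h9 (by ring) hfix⟩
  have h1 : 0 < (p - 1) * (b - 3 * a * t - t * (p + 1)) :=
    mul_pos (by linarith) (by nlinarith)
  have h2 : 0 ≤ ((q : ℝ) - 1) * t + 1 := by
    have : 0 ≤ ((q : ℝ) - 1) * t := ha
    linarith
  have h3 : (((q : ℝ) + 1) * t - 1) * (((q : ℝ) - 1) * t + 1) ≤ 0 :=
    mul_nonpos_of_nonpos_of_nonneg (by linarith) h2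
  linarith

/-- For `t` between the two thresholds, the field `calZ` produces a non-attracting limit. -/
theorem exists_critical (hq : 2 ≤ q) (ht0 : 0 < t) (ht1 : t ≤ 1) (h1 : tOne q < t)
    (h2 : t ≤ tTwo q) : ∃ l p, 0 < l ∧ 0 < p ∧ l⁻¹ = calZ q t ∧
      Tendsto (ratio q t l) atTop (𝓝 p) ∧ 1 ≤ 2 * l * mobius q t p * mobiusDeriv q t p := by
  have ha := coeffA_nonneg hq ht0.le
  have hb := one_le_coeffB hq ht0.le
  have hQ1 := critPoly_one q t
  have hta : t ≤ coeffA q t := by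
    rw [coeffA]
    nlinarith [one_le_cast_sub_one hq]
  rw [← not_le, le_tOne_iff, not_le] at h1
  rw [le_tTwo_iff hq ht0.le] at h2
  have hQ1pos : 0 < critPoly q t 1 := by
    have : 0 ≤ ((q : ℝ) - 1) * t := ha
    rw [hQ1]
    exact mul_pos (by linarith) (by linarith)
  have hat : 0 ≤ coeffA q t * t := by positivity
  have hS0 : 0 ≤ (coeffB q t - coeffA q t * t) * (coeffB q t - 9 * coeffA q t * t) :=
    mul_nonneg (by linarith) h2
  set s := √((coeffB q t - coeffA q t * t) * (coeffB q t - 9 * coeffA q t * t))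
  have hs : 0 ≤ s := Real.sqrt_nonneg _
  have hs2 : s ^ 2 = _ := Real.sq_sqrt hS0
  set p := (coeffB q t - 3 * coeffA q t * t - s) / (2 * t) with hpdef
  have hp : 2 * t * p = coeffB q t - 3 * coeffA q t * t - s := by
    rw [hpdef]
    field_simp
  have hab : t ≤ coeffA q t * coeffB q t := by nlinarith
  have hs_lt : s < coeffB q t - 3 * coeffA q t * t := by
    refine lt_of_pow_lt_pow_left₀ 2 (by linarith) ?_
    rw [hs2]
    nlinarith
  have hp0 : 0 < p := div_pos (by linarith) (by linarith)
  have hQ : critPoly q t p = 0 := by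
    have : 4 * t * critPoly q t p = 0 := by
      have hsp : s = coeffB q t - 3 * coeffA q t * t - 2 * t * p := by linarith
      rw [hsp] at hs2
      rw [critPoly]
      linear_combination hs2
    rcases mul_eq_zero.mp this with h | h
    · exact absurd h (by positivity)
    · exact h
  have habp : t * p ^ 2 ≤ coeffA q t * coeffB q t := by
    rw [critPoly] at hQ
    nlinarith
  have hp1 : 1 < p := by
    by_contra! hle
    rw [critPoly] at hQ hQ1pos
    set m := coeffB q t - 3 * coeffA q t * t - t * p with hm
    have e1 : m * p = coeffA q t * coeffB q t := by linear_combination -hQ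
    have e2 : 0 < (p - 1) * (m - t) := by
      rw [hm]
      linarith
    have e3 : m < t := by
      by_contra! h
      exact absurd e2 (not_lt.mpr (mul_nonpos_of_nonpos_of_nonneg (by linarith) (by linarith)))
    nlinarith
  have hd := mobius_denom_pos hq ht0.le hp0.le
  have hv := mobius_pos hq ht0.le hp0
  set l := p / mobius q t p ^ 2 with hl
  have hl0 : 0 < l := by positivity
  have hfix : p = l * mobius q t p ^ 2 := by
    rw [hl, div_mul_cancel₀ _ (by positivity)]
  have hsq : t ^ 2 * (p + coeffA q t) ^ 2 * p ^ 2 ≤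
      (t * p + coeffB q t) ^ 2 * coeffA q t ^ 2 := by
    have : (t * p * (p + coeffA q t)) ^ 2 ≤ ((t * p + coeffB q t) * coeffA q t) ^ 2 :=
      pow_le_pow_left₀ (by positivity) (by linarith) 2
    linarith
  have hK : ∀ u, 0 < u → u < p → u < l * mobius q t u ^ 2 := by
    intro u hu hup
    have e1 := mul_cofactor q t p u
    have e2 := sub_mul_cofactor hq ht0.le hp0 hu hfix
    rw [hQ, mul_zero, mul_zero, add_zero] at e1
    have e3 : t ^ 2 * (p + coeffA q t) ^ 2 * p * u < t ^ 2 * (p + coeffA q t) ^ 2 * p * p := by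
      gcongr
    have e4 : 0 < p * cofactor q t p u := by
      rw [e1]
      exact mul_pos_of_neg_of_neg (by linarith) (by linarith)
    have e5 := pos_of_mul_pos_right e4 hp0.le
    have e6 : ((p + coeffA q t) * (t * u + coeffB q t)) ^ 2 * (u - l * mobius q t u ^ 2) < 0 := by
      rw [← e2]
      exact mul_neg_of_neg_of_pos (by linarith) e5
    have e7 := neg_of_mul_neg_right e6 (sq_nonneg _)
    linarith
  have hl1 : 1 < l := by
    have := hK 1 one_pos hp1
    rwa [mobius_one hq ht0.le, one_pow, mul_one] at this
  obtain ⟨x, hx, hlim, hmin⟩ := exists_tendsto_ratio_of_one_lt hq ht0 ht1 hl1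
  have hx0 : 0 < x := by linarith
  have hxp : x = p := by
    refine (hmin p hp1.le hfix.ge).eq_of_not_lt fun hlt => ?_
    exact absurd (eq_of_tendsto_ratio hq ht0.le hx0.le hlim) (hK x hx0 hlt).ne
  rw [hxp] at hlim
  refine ⟨l, p, hl0, hp0, calZ_inv_of_fixed hq ht0 hl0 hp0 hs hs2 h2 hp hfix, hlim, ?_⟩
  rw [← not_lt, multiplier_lt_one_iff hq ht0.le hp0 hfix, hQ]
  exact lt_irrefl 0

end Parameters

section ZeroTemperature

variable {q : ℕ}

theorem ZZpair_zero_snd (q n : ℕ) (z : ℂ) : (ZZpair q 0 n z).2 = 1 := by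
  induction n with
  | zero => rfl
  | succ n ih => simp [ZZpair, ih]

theorem ZZpair_zero_inv_succ_fst (q n : ℕ) (w : ℂ) :
    (ZZpair q 0 (n + 1) w⁻¹).1 = w * (ZZpair q 0 n w⁻¹).1 ^ 2 := by
  simp [ZZpair]

/-- At `t = 0` zeros accumulate at no positive real point other than `1`. -/
theorem inv_notMem_BLY_zero (hq : 2 ≤ q) {l : ℝ} (hl0 : 0 < l) (hl : l ≠ 1) :
    ((l⁻¹ : ℝ) : ℂ) ∉ BLY 0 q := by
  have hlC : (l : ℂ) ≠ 0 := Complex.ofReal_ne_zero.mpr hl0.ne'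
  have hnorm : ‖(l : ℂ)‖ = l := by rw [Complex.norm_real, Real.norm_of_nonneg hl0.le]
  rw [Complex.ofReal_inv, inv_notMem_BLY_iff hlC]
  rcases hl.lt_or_gt with hlt | hgt
  · have h1 : ∀ᶠ w in 𝓝 (l : ℂ), ‖w‖ < 1 :=
      continuousAt_id.norm.eventually_lt continuousAt_const (by simpa only [id, hnorm] using hlt)
    filter_upwards [h1] with w hw n
    have h2 : ‖(ZZpair q 0 n w⁻¹).1‖ < 1 := by
      induction n with
      | zero => simpa [ZZpair] using hw
      | succ n ih =>
        rw [ZZpair_zero_inv_succ_fst, norm_mul, norm_pow]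
        exact mul_lt_one_of_nonneg_of_lt_one_left (norm_nonneg _) hw
          (pow_le_one₀ (norm_nonneg _) ih.le)
    refine Zrooted_ne_zero_of_ratio hq (u := (ZZpair q 0 n w⁻¹).1) ?_ ?_
    · linarith [(abs_le.mp (Complex.abs_re_le_norm (ZZpair q 0 n w⁻¹).1)).1]
    · simp [ZZpair_zero_snd]
  · set m := (1 + l) / 2 with hm
    have hm1 : 1 < m := by linarith
    have h1 : ∀ᶠ w in 𝓝 (l : ℂ), m < ‖w‖ :=
      continuousAt_const.eventually_lt continuousAt_id.norm (by simp only [hnorm]; linarith)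
    obtain ⟨N, hN⟩ := pow_unbounded_of_one_lt ((q : ℝ) - 1) hm1
    have hfin : ∀ᶠ w in 𝓝 (l : ℂ), ∀ n ∈ Finset.range N, Zrooted q 0 n w⁻¹ ≠ 0 := by
      rw [Filter.eventually_all_finset]
      intro n _
      exact (continuous_Zrooted_inv q 0 n).continuousAt.eventually_ne
        (Zrooted_inv_ofReal_ne_zero hq le_rfl hl0 n)
    filter_upwards [h1, hfin] with w hw hwfin n
    rcases lt_or_ge n N with hn | hn
    · exact hwfin n (Finset.mem_range.mpr hn)
    · have h2 : ∀ k, m ^ (k + 1) ≤ ‖(ZZpair q 0 k w⁻¹).1‖ := by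
        intro k
        induction k with
        | zero => simpa [ZZpair] using hw.le
        | succ k ih =>
          have h3 : 1 ≤ m ^ (k + 1) := one_le_pow₀ hm1.le
          rw [ZZpair_zero_inv_succ_fst, norm_mul, norm_pow, pow_succ, mul_comm]
          have h4 : m ^ (k + 1) ≤ ‖(ZZpair q 0 k w⁻¹).1‖ ^ 2 := by nlinarith
          gcongr
      intro h0
      rw [Zrooted, ZZpair_zero_snd, mul_one] at h0
      have h5 : ‖(ZZpair q 0 n w⁻¹).1‖ = (q : ℝ) - 1 := by
        have hcast : (ZZpair q 0 n w⁻¹).1 = ((-((q : ℝ) - 1) : ℝ) : ℂ) := by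
          push_cast
          linear_combination h0
        rw [hcast, Complex.norm_real, norm_neg,
          Real.norm_of_nonneg (by linarith [one_le_cast_sub_one hq])]
      have h6 : m ^ N ≤ m ^ (n + 1) := pow_le_pow_right₀ hm1.le (by omega)
      linarith [h2 n]

end ZeroTemperature

section Classification

variable {q : ℕ} {t : ℝ}

theorem tendsto_ratio_one (hq : 2 ≤ q) (ht0 : 0 ≤ t) :
    Tendsto (ratio q t 1) atTop (𝓝 1) := by
  have h : ∀ n, ratio q t 1 n = 1 := by
    intro n
    induction n with
    | zero => rfl
    | succ n ih => rw [ratio, ih, mobius_one hq ht0, one_pow, mul_one]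
  simp [funext h]

theorem one_mem_BLY_iff (hq : 2 ≤ q) (ht0 : 0 ≤ t) (ht1 : t ≤ 1) :
    (1 : ℂ) ∈ BLY t q ↔ t ≤ tOne q := by
  have hlim := tendsto_ratio_one hq ht0
  have hmult := multiplier_lt_one_iff hq ht0 one_pos
    (eq_of_tendsto_ratio hq ht0 zero_le_one hlim)
  have hpos : 0 < ((q : ℝ) - 1) * t + 1 := by
    have : 0 ≤ ((q : ℝ) - 1) * t := coeffA_nonneg hq ht0
    linarith
  rw [critPoly_one, mul_pos_iff_of_pos_right hpos, sub_pos] at hmult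
  rw [le_tOne_iff]
  constructor
  · intro h
    by_contra! hlt
    have := inv_notMem_BLY_of_attracting hq ht0 ht1 one_pos one_pos hlim (hmult.mpr hlt)
    simp only [inv_one, Complex.ofReal_one] at this
    exact this h
  · intro h
    have := inv_mem_BLY_of_not_attracting hq ht0 ht1 one_pos one_pos hlim
      (not_lt.mp fun hlt => absurd (hmult.mp hlt) (not_lt.mpr h))
    simpa only [inv_one, Complex.ofReal_one] using this

theorem tOne_pos (q : ℕ) : 0 < tOne q := by
  rw [tOne]
  positivity

theorem eq_calZ_of_mem_BLY (hq : 2 ≤ q) (ht0 : 0 ≤ t) (ht1 : t ≤ 1) {x : ℝ} (hx0 : 0 < x)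
    (hx1 : x ≠ 1) (hx : (x : ℂ) ∈ BLY t q) : tOne q < t ∧ t ≤ tTwo q ∧ x = calZ q t := by
  obtain ⟨l, hl0, rfl⟩ : ∃ l : ℝ, 0 < l ∧ x = l⁻¹ := ⟨x⁻¹, inv_pos.mpr hx0, (inv_inv x).symm⟩
  have hl1 : l ≠ 1 := fun h => hx1 (by rw [h, inv_one])
  rcases ht0.eq_or_lt with rfl | ht
  · exact absurd hx (inv_notMem_BLY_zero hq hl0 hl1)
  rcases hl1.lt_or_gt with hlt | hgt
  · obtain ⟨p, hp0, hp1, hlim, hmax⟩ := exists_tendsto_ratio_of_lt_one hq ht ht1 hl0 hlt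
    have hfix := eq_of_tendsto_ratio hq ht0 hp0.le hlim
    have hcrit := critPoly_pos_of_lt_one hq ht hp0 hp1 hfix hmax
    exact absurd hx (inv_notMem_BLY_of_attracting hq ht0 ht1 hl0 hp0 hlim
      ((multiplier_lt_one_iff hq ht0 hp0 hfix).mpr hcrit))
  · obtain ⟨p, hp1, hlim, hmin⟩ := exists_tendsto_ratio_of_one_lt hq ht ht1 hgt
    have hp0 : 0 < p := by linarith
    have hfix := eq_of_tendsto_ratio hq ht0 hp0.le hlim
    rcases attracting_or_critical_of_one_lt hq ht hp1 hfix hmin with h | ⟨hQ, hab⟩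
    · exact absurd hx (inv_notMem_BLY_of_attracting hq ht0 ht1 hl0 hp0 hlim
        ((multiplier_lt_one_iff hq ht0 hp0 hfix).mpr h))
    · exact calZ_inv_of_critical hq ht hl0 hp1 hfix hQ hab

theorem calZ_mem_BLY (hq : 2 ≤ q) (ht1 : t ≤ 1) (h1 : tOne q < t) (h2 : t ≤ tTwo q) :
    0 < calZ q t ∧ ((calZ q t : ℝ) : ℂ) ∈ BLY t q := by
  have ht0 : 0 < t := (tOne_pos q).trans h1
  obtain ⟨l, p, hl, hp, hcal, hlim, hmult⟩ := exists_critical hq ht0 ht1 h1 h2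
  rw [← hcal]
  exact ⟨inv_pos.mpr hl, inv_mem_BLY_of_not_attracting hq ht0.le ht1 hl hp hlim hmult⟩

/-- The thresholds are ordered. -/
theorem tOne_le_tTwo (hq : 2 ≤ q) : tOne q ≤ tTwo q := by
  have h1 := one_le_cast_sub_one hq
  rw [le_tTwo_iff hq (tOne_pos q).le, coeffA, coeffB]
  have h : ((q : ℝ) + 1) * tOne q = 1 := by
    rw [tOne, add_comm, mul_one_div_cancel (by positivity)]
  have hpos := tOne_pos q
  set s := tOne q
  have : 1 + ((q : ℝ) - 2) * s - 9 * (((q : ℝ) - 1) * s) * s =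
      2 * ((q : ℝ) - 2) ^ 2 * s ^ 2 := by
    linear_combination (-1 - (2 * (q : ℝ) - 1) * s) * h
  rw [this]
  positivity

end Classification

/-- **Theorem A (rooted case).** For `q ≥ 2` and `0 ≤ t ≤ 1`, the intersection of the
accumulation set of Lee–Yang zeros of the rooted binary Cayley tree with `(0,∞)` is
`{1}` for `0 ≤ t ≤ t₁(q)`, is `{𝒵_q(t)}` for `t₁(q) < t ≤ t₂(q)`, and is empty for
`t₂(q) < t ≤ 1`. -/
theorem potts_rooted_ferromagnetic_accumulation
    (q : ℕ) (hq : 2 ≤ q) (t : ℝ) (ht0 : 0 ≤ t) (ht1 : t ≤ 1) :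
    (t ≤ tOne q → BLY t q ∩ posAxis = {(1 : ℂ)}) ∧
    (tOne q < t → t ≤ tTwo q → BLY t q ∩ posAxis = {((calZ q t : ℝ) : ℂ)}) ∧
    (tTwo q < t → BLY t q ∩ posAxis = ∅) := by
  refine ⟨fun h => ?_, fun h1 h2 => ?_, fun h => ?_⟩
  · ext z
    simp only [mem_inter_iff, mem_singleton_iff]
    constructor
    · rintro ⟨hz, x, hx0, rfl⟩
      by_contra hne
      have := (eq_calZ_of_mem_BLY hq ht0 ht1 hx0 (fun hx => hne (by rw [hx]; simp)) hz).1
      linarith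
    · rintro rfl
      exact ⟨(one_mem_BLY_iff hq ht0 ht1).mpr h, 1, one_pos, by simp⟩
  · ext z
    simp only [mem_inter_iff, mem_singleton_iff]
    constructor
    · rintro ⟨hz, x, hx0, rfl⟩
      have hx1 : x ≠ 1 := by
        rintro rfl
        rw [Complex.ofReal_one, one_mem_BLY_iff hq ht0 ht1] at hz
        linarith
      rw [(eq_calZ_of_mem_BLY hq ht0 ht1 hx0 hx1 hz).2.2]
    · rintro rfl
      obtain ⟨g1, g2⟩ := calZ_mem_BLY hq ht1 h1 h2
      exact ⟨g2, _, g1, rfl⟩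
  · rw [eq_empty_iff_forall_notMem]
    rintro z ⟨hz, x, hx0, rfl⟩
    rcases eq_or_ne x 1 with rfl | hx1
    · rw [Complex.ofReal_one, one_mem_BLY_iff hq ht0 ht1] at hz
      linarith [tOne_le_tTwo hq]
    · linarith [(eq_calZ_of_mem_BLY hq ht0 ht1 hx0 hx1 hz).2.1]
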